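/- arXiv:2501.03660 — 8 statements merged into one kernel-verified Lean document; each statement's English description precedes it below -/
import Mathlib

section
/- Let X and Y be indecomposable left quasigroups and p : X → Y a surjective homomorphism. Set G^{ker p} = {h ∈ G(X) : p(h(x)) = p(x) for all x ∈ X}. Then the relation α on X defined by x α y if and only if y = h(x) for some h ∈ G^{ker p} is a congruence of X contained in ker p, and the induced surjective homomorphism q : X/α → Y satisfies p = q ∘ r (where r : X → X/α is the canonical projection) and is a covering, i.e. the induced group epimorphism G(X/α) → G(Y) sending σ_{[x]} to σ_{p(x)} is a group isomorphism. -/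
/-- The permutation group `G(X)` of a left quasigroup, generated by the left translations. -/
def permGroup {X : Type*} (σ : X → Equiv.Perm X) : Subgroup (Equiv.Perm X) :=
  Subgroup.closure (Set.range σ)

/-- The left translation `σ_x` as an element of `G(X)`. -/
def sigmaG {X : Type*} (σ : X → Equiv.Perm X) (x : X) : permGroup σ :=
  ⟨σ x, Subgroup.subset_closure ⟨x, rfl⟩⟩

/-- The displacement group `Dis(X)`: the normal closure in `G(X)` of the
elements `σ_x ∘ σ_y⁻¹`. -/
def dis {X : Type*} (σ : X → Equiv.Perm X) : Subgroup ↥(permGroup σ) :=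
  Subgroup.normalClosure {g : ↥(permGroup σ) | ∃ x y : X, (g : Equiv.Perm X) = σ x * (σ y)⁻¹}

/-- A left quasigroup is indecomposable if `G(X)` acts transitively. -/
def Indecomposable {X : Type*} (σ : X → Equiv.Perm X) : Prop :=
  ∀ x y : X, ∃ g ∈ permGroup σ, g x = y

/-- A left quasigroup is irretractable if `σ_x = σ_y` implies `x = y`. -/
def Irretractable {X : Type*} (σ : X → Equiv.Perm X) : Prop :=
  ∀ x y : X, σ x = σ y → x = y

/-- A left quasigroup is latin if every right translation is bijective. -/
def LatinLQ {X : Type*} (σ : X → Equiv.Perm X) : Prop :=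
  ∀ x : X, Function.Bijective fun y => σ y x

/-- A congruence of a left quasigroup. -/
def IsCongruence {X : Type*} (σ : X → Equiv.Perm X) (r : X → X → Prop) : Prop :=
  Equivalence r ∧
  (∀ x x' y y' : X, r x x' → r y y' → r (σ x y) (σ x' y')) ∧
  (∀ x x' y y' : X, r x x' → r y y' → r ((σ x).symm y) ((σ x').symm y'))

/-- A left quasigroup is simple if it is indecomposable and its only congruences are
the equality relation and the total relation. -/
def SimpleLQ {X : Type*} (σ : X → Equiv.Perm X) : Prop :=
  Indecomposable σ ∧ ∀ r : X → X → Prop, IsCongruence σ r →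
    (∀ a b : X, r a b ↔ a = b) ∨ (∀ a b : X, r a b)

/-- The cycle set identity `(x·y)·(x·z) = (y·x)·(y·z)`. -/
def CycleSetLaw {X : Type*} (σ : X → Equiv.Perm X) : Prop :=
  ∀ x y z : X, σ (σ x y) (σ x z) = σ (σ y x) (σ y z)

/-- Non-degeneracy: the squaring map `x ↦ x·x` is bijective. -/
def Nondeg {X : Type*} (σ : X → Equiv.Perm X) : Prop :=
  Function.Bijective fun x : X => σ x x

/-- The displacement group acts transitively. -/
def DisTransitive {X : Type*} (σ : X → Equiv.Perm X) : Prop :=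
  ∀ x y : X, ∃ g ∈ dis σ, (g : Equiv.Perm X) x = y

/-- The relation `α` on `X`: `x α y` iff `y = h(x)` for some `h` in
`G^{ker p} = {h ∈ G(X) : p(h(x)) = p(x) for all x}`. -/
def kerCongr {X Y : Type*} (σX : X → Equiv.Perm X) (p : X → Y) (a b : X) : Prop :=
  ∃ h : Equiv.Perm X, h ∈ permGroup σX ∧ (∀ z : X, p (h z) = p z) ∧ h a = b

section HomomorphismPermGroup

variable {X Y : Type*} {σX : X → Equiv.Perm X} {σY : Y → Equiv.Perm Y} {p : X → Y}

/-- Every element of `G(X)` descends along a homomorphism `X → Y` to an element of `G(Y)`. -/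
theorem exists_permGroup_semiconj_of_mem (hhom : ∀ x y, p (σX x y) = σY (p x) (p y))
    {g : Equiv.Perm X} (hg : g ∈ permGroup σX) :
    ∃ g' ∈ permGroup σY, ∀ x, p (g x) = g' (p x) := by
  induction hg using Subgroup.closure_induction with
  | mem g hg =>
    obtain ⟨x, rfl⟩ := hg
    exact ⟨σY (p x), (sigmaG σY (p x)).2, hhom x⟩
  | one => exact ⟨1, one_mem _, fun _ => rfl⟩
  | mul a b _ _ iha ihb =>
    obtain ⟨a', ha', ha⟩ := iha
    obtain ⟨b', hb', hb⟩ := ihb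
    exact ⟨a' * b', mul_mem ha' hb', fun x => by simp [ha, hb]⟩
  | inv a _ iha =>
    obtain ⟨a', ha', ha⟩ := iha
    refine ⟨a'⁻¹, inv_mem ha', fun x => ?_⟩
    rw [Equiv.Perm.eq_inv_iff_eq, ← ha, Equiv.Perm.coe_inv, Equiv.apply_symm_apply]

/-- Every element of `G(Y)` lifts along a surjective homomorphism `X → Y` to an element of
`G(X)`. -/
theorem exists_permGroup_semiconj_of_surjective (hsurj : Function.Surjective p)
    (hhom : ∀ x y, p (σX x y) = σY (p x) (p y))
    {g' : Equiv.Perm Y} (hg' : g' ∈ permGroup σY) :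
    ∃ g ∈ permGroup σX, ∀ x, p (g x) = g' (p x) := by
  induction hg' using Subgroup.closure_induction with
  | mem g hg =>
    obtain ⟨y, rfl⟩ := hg
    obtain ⟨x, rfl⟩ := hsurj y
    exact ⟨σX x, (sigmaG σX x).2, hhom x⟩
  | one => exact ⟨1, one_mem _, fun _ => rfl⟩
  | mul a b _ _ iha ihb =>
    obtain ⟨a', ha', ha⟩ := iha
    obtain ⟨b', hb', hb⟩ := ihb
    exact ⟨a' * b', mul_mem ha' hb', fun x => by simp [ha, hb]⟩
  | inv a _ iha =>
    obtain ⟨a', ha', ha⟩ := iha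
    refine ⟨a'⁻¹, inv_mem ha', fun x => ?_⟩
    rw [Equiv.Perm.eq_inv_iff_eq, ← ha, Equiv.Perm.coe_inv, Equiv.apply_symm_apply]

/-- A surjective homomorphism `p : X → Y` induces a group homomorphism `G(X) → G(Y)` for which
`p` is equivariant. -/
theorem exists_permGroup_hom (hsurj : Function.Surjective p)
    (hhom : ∀ x y, p (σX x y) = σY (p x) (p y)) :
    ∃ F : permGroup σX →* permGroup σY,
      ∀ (g : permGroup σX) (x : X), p (g.1 x) = (F g).1 (p x) := by
  choose f hf hpf using fun g : permGroup σX => exists_permGroup_semiconj_of_mem hhom g.2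
  refine ⟨MonoidHom.mk' (fun g => ⟨f g, hf g⟩) fun a b => ?_, hpf⟩
  ext y
  obtain ⟨x, rfl⟩ := hsurj y
  change f (a * b) (p x) = f a (f b (p x))
  rw [← hpf, ← hpf, ← hpf]
  rfl

end HomomorphismPermGroup

section KerCongr

variable {X Y : Type*} {σX : X → Equiv.Perm X} {σY : Y → Equiv.Perm Y} {p : X → Y}

theorem kerCongr_equivalence (σX : X → Equiv.Perm X) (p : X → Y) :
    Equivalence (kerCongr σX p) where
  refl x := ⟨1, one_mem _, fun _ => rfl, rfl⟩
  symm := by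
    rintro a _ ⟨h, hh, hp, rfl⟩
    exact ⟨h⁻¹, inv_mem hh, fun z => by rw [← hp, Equiv.Perm.coe_inv, Equiv.apply_symm_apply], by simp⟩
  trans := by
    rintro a _ _ ⟨h, hh, hp, rfl⟩ ⟨k, hk, hq, rfl⟩
    exact ⟨k * h, mul_mem hk hh, fun z => by simp [hp, hq], rfl⟩

theorem kerCongr.map_eq {a b : X} (h : kerCongr σX p a b) : p a = p b := by
  obtain ⟨h, -, hp, rfl⟩ := h
  exact (hp a).symm

/-- Elements of `G(X)` with the same image in `G(Y)` preserve `kerCongr`. -/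
theorem kerCongr.apply (hhom : ∀ x y, p (σX x y) = σY (p x) (p y))
    {g k : Equiv.Perm X} (hg : g ∈ permGroup σX) (hk : k ∈ permGroup σX)
    (hgk : ∀ z, p (g z) = p (k z)) {a b : X} (hab : kerCongr σX p a b) :
    kerCongr σX p (g a) (k b) := by
  obtain ⟨h, hh, hp, rfl⟩ := hab
  obtain ⟨k', -, hk'⟩ := exists_permGroup_semiconj_of_mem hhom hk
  refine ⟨k * h * g⁻¹, mul_mem (mul_mem hk hh) (inv_mem hg), fun z => ?_, by simp⟩
  simp only [Equiv.Perm.mul_apply]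
  rw [hk', hp, ← hk', ← hgk, Equiv.Perm.coe_inv, Equiv.apply_symm_apply]

theorem isCongruence_kerCongr (hhom : ∀ x y, p (σX x y) = σY (p x) (p y)) :
    IsCongruence σX (kerCongr σX p) := by
  refine ⟨kerCongr_equivalence σX p, fun x x' y y' hx hy => ?_, fun x x' y y' hx hy => ?_⟩
  · exact hy.apply hhom (sigmaG σX x).2 (sigmaG σX x').2 fun z => by
      simp only [sigmaG, hhom, hx.map_eq]
  · refine hy.apply hhom (inv_mem (sigmaG σX x).2) (inv_mem (sigmaG σX x').2) fun z => ?_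
    apply (σY (p x)).injective
    rw [← hhom, hx.map_eq, ← hhom]
    simp [sigmaG]

end KerCongr

/-- The left translations of the quotient of a left quasigroup by a congruence. -/
def IsCongruence.quotTranslation {X : Type*} {σ : X → Equiv.Perm X} {r : X → X → Prop}
    (hr : IsCongruence σ r) (u : Quot r) : Equiv.Perm (Quot r) where
  toFun := Quot.map₂ (fun x y => σ x y) (fun x _ _ h => hr.2.1 _ _ _ _ (hr.1.refl x) h)
    (fun _ _ y h => hr.2.1 _ _ _ _ h (hr.1.refl y)) u
  invFun := Quot.map₂ (fun x y => (σ x).symm y)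
    (fun x _ _ h => hr.2.2 _ _ _ _ (hr.1.refl x) h)
    (fun _ _ y h => hr.2.2 _ _ _ _ h (hr.1.refl y)) u
  left_inv v := by
    induction u using Quot.ind
    induction v using Quot.ind
    simp
  right_inv v := by
    induction u using Quot.ind
    induction v using Quot.ind
    simp

/-- for a surjective homomorphism `p : X → Y` of indecomposable left
quasigroups, the relation `α = kerCongr σX p` is a congruence contained in `ker p`,
and the induced surjective homomorphism `q : X/α → Y` satisfies `p = q ∘ r` and is a
covering: the induced group epimorphism `G(X/α) → G(Y)`, `σ_{[x]} ↦ σ_{p(x)}`, is a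
group isomorphism. -/
theorem stmt_1 {X Y : Type*} (σX : X → Equiv.Perm X) (σY : Y → Equiv.Perm Y)
    (hX : Indecomposable σX) (hY : Indecomposable σY)
    (p : X → Y) (hsurj : Function.Surjective p)
    (hhom : ∀ x y : X, p (σX x y) = σY (p x) (p y)) :
    IsCongruence σX (kerCongr σX p) ∧
    (∀ a b : X, kerCongr σX p a b → p a = p b) ∧
    ∃ (σQ : Quot (kerCongr σX p) → Equiv.Perm (Quot (kerCongr σX p)))
      (q : Quot (kerCongr σX p) → Y),
      (∀ x y : X, σQ (Quot.mk (kerCongr σX p) x) (Quot.mk (kerCongr σX p) y) =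
        Quot.mk (kerCongr σX p) (σX x y)) ∧
      Function.Surjective q ∧
      (∀ u v : Quot (kerCongr σX p), q (σQ u v) = σY (q u) (q v)) ∧
      (∀ x : X, q (Quot.mk (kerCongr σX p) x) = p x) ∧
      ∃ F : ↥(permGroup σQ) ≃* ↥(permGroup σY),
        ∀ x : X, F (sigmaG σQ (Quot.mk (kerCongr σX p) x)) = sigmaG σY (p x) := by
  have hc := isCongruence_kerCongr hhom
  let σQ := hc.quotTranslation
  let q : Quot (kerCongr σX p) → Y := Quot.lift p fun _ _ h => h.map_eq
  have hq : Function.Surjective q := fun y => (hsurj y).imp' (Quot.mk _) fun _ h => h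
  have hqhom : ∀ u v, q (σQ u v) = σY (q u) (q v) := by
    rintro ⟨x⟩ ⟨y⟩
    exact hhom x y
  refine ⟨hc, fun _ _ h => h.map_eq, σQ, q, fun _ _ => rfl, hq, hqhom, fun _ => rfl, ?_⟩
  obtain ⟨F, hF⟩ := exists_permGroup_hom hq hqhom
  refine ⟨MulEquiv.ofBijective F ⟨(injective_iff_map_eq_one F).2 fun g hg => ?_, fun g' => ?_⟩,
    fun x => ?_⟩
  · obtain ⟨k, hk, hkg⟩ := exists_permGroup_semiconj_of_surjective (σX := σX) (σY := σQ)
      Quot.mk_surjective (fun _ _ => rfl) g.2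
    ext ⟨x⟩
    have hpk : ∀ z, p (k z) = p z := fun z => by
      change q (Quot.mk _ (k z)) = q (Quot.mk _ z)
      rw [hkg, hF, hg]
      rfl
    exact (hkg x).symm.trans (Quot.sound ⟨k, hk, hpk, rfl⟩).symm
  · obtain ⟨g, hg, hgg'⟩ := exists_permGroup_semiconj_of_surjective hq hqhom g'.2
    refine ⟨⟨g, hg⟩, ?_⟩
    ext y
    obtain ⟨u, rfl⟩ := hq y
    rw [← hF, ← hgg']
  · ext y
    obtain ⟨u, rfl⟩ := hq y
    exact (hF _ u).symm.trans (hqhom _ u)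
end

section
/- Let (B,+,∘) be a left brace and let C and D be left ideals of B such that λ_x(y) = y for all x ∈ C + D and y ∈ D. Then for every y ∈ D the restriction of λ_y to C is an automorphism of (C,+,∘); in fact λ_y(z) = y ∘ z ∘ y⁻¹ for all z ∈ C, where y⁻¹ denotes the inverse in (B,∘). -/
/-- A left brace structure on an abelian group `(B,+)`: a second (multiplicative)
group operation `mul` satisfying the brace law `x∘(y+z) + x = x∘y + x∘z`. -/
structure LeftBrace (B : Type*) [AddCommGroup B] where
  mul : B → B → B
  one : B
  inv : B → B
  mul_assoc : ∀ a b c : B, mul (mul a b) c = mul a (mul b c)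
  one_mul : ∀ a : B, mul one a = a
  mul_one : ∀ a : B, mul a one = a
  inv_mul_cancel : ∀ a : B, mul (inv a) a = one
  brace : ∀ x y z : B, mul x (y + z) + x = mul x y + mul x z

/-- The map `λ_x(y) = -x + x∘y`. -/
def LeftBrace.lam {B : Type*} [AddCommGroup B] (S : LeftBrace B) (x y : B) : B :=
  -x + S.mul x y

/-- A left ideal: a subgroup of `(B,∘)` with `λ_x(I) ⊆ I` for every `x ∈ B`. -/
def LeftBrace.IsLeftIdeal {B : Type*} [AddCommGroup B] (S : LeftBrace B) (I : Set B) : Prop :=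
  S.one ∈ I ∧ (∀ a ∈ I, ∀ b ∈ I, S.mul a b ∈ I) ∧ (∀ a ∈ I, S.inv a ∈ I) ∧
    ∀ x : B, ∀ y ∈ I, S.lam x y ∈ I

namespace LeftBrace

variable {B : Type*} [AddCommGroup B] (S : LeftBrace B)

theorem mul_zero (x : B) : S.mul x 0 = x := by
  have h := S.brace x 0 0
  rw [add_zero] at h
  exact (add_left_cancel h).symm

theorem one_eq_zero : S.one = 0 :=
  (S.mul_zero S.one).symm.trans (S.one_mul 0)

theorem mul_inv_cancel (x : B) : S.mul x (S.inv x) = S.one := by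
  calc S.mul x (S.inv x)
      = S.mul (S.mul (S.inv (S.inv x)) (S.inv x)) (S.mul x (S.inv x)) := by
        rw [S.inv_mul_cancel, S.one_mul]
    _ = S.mul (S.inv (S.inv x)) (S.mul (S.mul (S.inv x) x) (S.inv x)) := by
        simp only [S.mul_assoc]
    _ = S.one := by rw [S.inv_mul_cancel, S.one_mul, S.inv_mul_cancel]

theorem mul_eq_add_lam (x y : B) : S.mul x y = x + S.lam x y := by
  simp [lam]

theorem lam_add (x y z : B) : S.lam x (y + z) = S.lam x y + S.lam x z := by
  have h := S.brace x y z
  simp only [mul_eq_add_lam] at h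
  apply add_left_cancel (a := x + x)
  calc x + x + S.lam x (y + z) = x + S.lam x (y + z) + x := by abel
    _ = x + S.lam x y + (x + S.lam x z) := h
    _ = x + x + (S.lam x y + S.lam x z) := by abel

theorem lam_one (y : B) : S.lam S.one y = y := by
  rw [lam, S.one_mul, S.one_eq_zero, neg_zero, zero_add]

theorem lam_lam (x y z : B) : S.lam x (S.lam y z) = S.lam (S.mul x y) z := by
  have h := S.mul_assoc x y z
  rw [S.mul_eq_add_lam (S.mul x y) z, S.mul_eq_add_lam x (S.mul y z), S.mul_eq_add_lam y z,
    S.lam_add, S.mul_eq_add_lam x y, add_assoc, ← S.mul_eq_add_lam x y] at h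
  exact (add_left_cancel (add_left_cancel h)).symm

theorem lam_inv_lam (x y : B) : S.lam (S.inv x) (S.lam x y) = y := by
  rw [lam_lam, S.inv_mul_cancel, lam_one]

theorem lam_lam_inv (x y : B) : S.lam x (S.lam (S.inv x) y) = y := by
  rw [lam_lam, mul_inv_cancel, lam_one]

/-- If `λ_{λ_y(z)}` fixes `y`, then `λ_y(z)` is the conjugate of `z` by `y`. -/
theorem lam_eq_conj {y z : B} (h : S.lam (S.lam y z) y = y) :
    S.lam y z = S.mul (S.mul y z) (S.inv y) := by
  have hmul : S.mul y z = S.mul (S.lam y z) y := by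
    rw [S.mul_eq_add_lam (S.lam y z) y, h, S.mul_eq_add_lam y z, add_comm]
  rw [hmul, S.mul_assoc, mul_inv_cancel, S.mul_one]

theorem conj_mul (y z w : B) :
    S.mul (S.mul y (S.mul z w)) (S.inv y) =
      S.mul (S.mul (S.mul y z) (S.inv y)) (S.mul (S.mul y w) (S.inv y)) := by
  simp only [S.mul_assoc]
  rw [← S.mul_assoc (S.inv y) y, S.inv_mul_cancel, S.one_mul]

end LeftBrace

/-- if `C, D` are left ideals of a left brace `B` with `λ_x(y) = y` for all
`x ∈ C + D` and `y ∈ D`, then for every `y ∈ D` the restriction of `λ_y` to `C` is an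
automorphism of `(C,+,∘)`; in fact `λ_y(z) = y ∘ z ∘ y⁻¹` for all `z ∈ C`. -/
theorem stmt_2 {B : Type*} [AddCommGroup B] (S : LeftBrace B) (C D : Set B)
    (hC : S.IsLeftIdeal C) (hD : S.IsLeftIdeal D)
    (hfix : ∀ c ∈ C, ∀ d ∈ D, ∀ y ∈ D, S.lam (c + d) y = y) :
    ∀ y ∈ D,
      (∀ z ∈ C, S.lam y z = S.mul (S.mul y z) (S.inv y)) ∧
      Set.BijOn (S.lam y) C C ∧
      (∀ z ∈ C, ∀ w ∈ C, S.lam y (z + w) = S.lam y z + S.lam y w) ∧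
      (∀ z ∈ C, ∀ w ∈ C, S.lam y (S.mul z w) = S.mul (S.lam y z) (S.lam y w)) := by
  intro y hy
  have hconj : ∀ z ∈ C, S.lam y z = S.mul (S.mul y z) (S.inv y) := fun z hz => by
    refine S.lam_eq_conj ?_
    simpa [S.one_eq_zero] using hfix _ (hC.2.2.2 y z hz) _ hD.1 y hy
  refine ⟨hconj, ?_, fun z _ w _ => S.lam_add y z w, fun z hz w hw => ?_⟩
  · exact Set.InvOn.bijOn (f' := S.lam (S.inv y))
      ⟨fun z _ => S.lam_inv_lam y z, fun z _ => S.lam_lam_inv y z⟩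
      (hC.2.2.2 y) (hC.2.2.2 (S.inv y))
  · rw [hconj _ (hC.2.1 z hz w hw), hconj z hz, hconj w hw, S.conj_mul]
end

section
/- Let X be a finite indecomposable non-degenerate cycle set such that G(X) has a minimal normal subgroup acting transitively on X (i.e. the action of G(X) is innately transitive). Then |X| is a prime number p and X is the trivial indecomposable cycle set of size p, i.e. there is a p-cycle γ ∈ Sym(X) with x·y = γ(y) for all x,y ∈ X. -/
section Burnside

open Polynomial

theorem Multiset.sum_div_card_integral_rootsOfUnity (s : Multiset ℂ) (k : ℕ) (hk : 0 < k)
    (hs : ∀ z ∈ s, z ^ k = 1) (hintegral : IsIntegral ℤ (s.sum / s.card)) (h0 : s.sum ≠ 0) :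
    ‖s.sum / s.card‖ = 1 := by
  have hcard : (s.card : ℂ) ≠ 0 := by
    intro h
    have : s = 0 := by simpa using h
    simp [this] at h0
  let S : Set ℂ := {z | z ^ k = 1}
  have hSfin : S.Finite := by
    refine Set.Finite.subset (nthRoots k (1 : ℂ)).toFinset.finite_toSet fun z hz => ?_
    have hz : z ^ k = 1 := hz
    simpa [mem_nthRoots hk] using hz
  let K := IntermediateField.adjoin ℚ S
  have hfd : FiniteDimensional ℚ K := by
    have := hSfin.to_subtype
    refine IntermediateField.finiteDimensional_adjoin fun z hz => ?_
    exact ⟨X ^ k - 1, monic_X_pow_sub_C 1 hk.ne', by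
      have hz : z ^ k = 1 := hz
      simp [hz]⟩
  have : NumberField K := ⟨⟩
  lift s to Multiset K using fun z hz => IntermediateField.subset_adjoin ℚ S (hs z hz)
  have hs' : ∀ z ∈ s, z ^ k = 1 := fun z hz => by
    have := hs (z : ℂ) (Multiset.mem_map_of_mem _ hz)
    exact_mod_cast this
  have hval : (((s.sum / s.card : K)) : ℂ)
      = (s.map ((↑) : K → ℂ)).sum / (s.map ((↑) : K → ℂ)).card := by
    simp only [Multiset.card_map]
    push_cast
    rfl
  rw [← hval] at hintegral ⊢
  have hx0 : (s.sum / s.card : K) ≠ 0 := by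
    intro h
    rw [h] at hval
    exact (div_ne_zero h0 hcard) (by simpa using hval.symm)
  have hintegral' : IsIntegral ℤ (s.sum / s.card : K) :=
    (isIntegral_algebraMap_iff (algebraMap K ℂ).injective).mp hintegral
  obtain ⟨n, hn, hpow⟩ := NumberField.Embeddings.pow_eq_one_of_norm_le_one K ℂ hx0 hintegral' (by
    intro φ
    rw [map_div₀, map_multiset_sum, map_natCast, norm_div]
    have hb : ‖(s.map φ).sum‖ ≤ s.card := by
      refine (norm_multiset_sum_le _).trans ?_
      rw [Multiset.map_map, Multiset.map_congr rfl (g := fun _ => (1 : ℝ))]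
      · simp
      · intro z hz
        exact Complex.norm_eq_one_of_pow_eq_one (n := k) (by
          rw [← map_pow, hs' z hz, map_one]) hk.ne'
    simpa using div_le_one_of_le₀ hb (by positivity))
  refine Complex.norm_eq_one_of_pow_eq_one (n := n) ?_ hn.ne'
  exact_mod_cast hpow

theorem Multiset.eq_of_norm_sum_div_card_eq_one (s : Multiset ℂ) (hs : ∀ z ∈ s, ‖z‖ = 1)
    (h : ‖s.sum / s.card‖ = 1) : ∀ z ∈ s, z = s.sum / s.card := by
  have hcard : (s.card : ℂ) ≠ 0 := by
    intro h0
    simp [h0] at h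
  set u : ℂ := s.sum / s.card with hu
  have hre : (s.map fun z => 1 - (z * (starRingEnd ℂ) u).re).sum = 0 := by
    have h1 : (s.map fun z => (z * (starRingEnd ℂ) u).re).sum
        = (s.sum * (starRingEnd ℂ) u).re :=
      (map_multiset_sum
        (Complex.reAddGroupHom.comp (AddMonoidHom.mulRight ((starRingEnd ℂ) u))) s).symm
    rw [Multiset.sum_map_sub, h1]
    have h2 : s.sum = s.card * u := by rw [hu]; field_simp
    rw [h2, mul_assoc, Complex.mul_conj, Complex.normSq_eq_norm_sq, h]
    simp
  intro z hz
  have hnorm : ∀ w ∈ s, ‖w * (starRingEnd ℂ) u‖ = 1 := fun w hw => by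
    rw [norm_mul, hs w hw, RCLike.norm_conj, h, one_mul]
  have hz1 : 1 - (z * (starRingEnd ℂ) u).re = 0 := by
    refine Multiset.all_zero_of_le_zero_le_of_sum_eq_zero ?_ hre _ (Multiset.mem_map_of_mem _ hz)
    intro r hr
    obtain ⟨w, hw, rfl⟩ := Multiset.mem_map.mp hr
    have := Complex.re_le_norm (w * (starRingEnd ℂ) u)
    rw [hnorm w hw] at this
    linarith
  have hz2 : z * (starRingEnd ℂ) u = 1 := by
    have hre1 : (z * (starRingEnd ℂ) u).re = 1 := by linarith
    have hsq := Complex.sq_norm (z * (starRingEnd ℂ) u)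
    rw [hnorm z hz, Complex.normSq_apply, hre1] at hsq
    refine Complex.ext hre1 ?_
    simpa using hsq
  calc z = z * ((starRingEnd ℂ) u * u) := by
        rw [mul_comm _ u, Complex.mul_conj, Complex.normSq_eq_norm_sq, h]; simp
    _ = u := by rw [← mul_assoc, hz2, one_mul]

theorem Matrix.trace_eq_zero_or_scalar {n : Type*} [Fintype n] [DecidableEq n] [Nonempty n]
    (M : Matrix n n ℂ) (k : ℕ) (hk : 0 < k) (hM : M ^ k = 1)
    (hintegral : IsIntegral ℤ (M.trace / Fintype.card n)) :
    M.trace = 0 ∨ ∃ c : ℂ, M = Matrix.scalar n c := by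
  refine or_iff_not_imp_left.mpr fun h0 => ?_
  have hann : aeval M (X ^ k - 1 : ℂ[X]) = 0 := by simp [hM]
  have hdvd : minpoly ℂ M ∣ X ^ k - 1 := minpoly.dvd ℂ M hann
  have hroot : ∀ z ∈ M.charpoly.roots, z ^ k = 1 := fun z hz => by
    have := spectrum.pow_mem_pow M k
      (Matrix.mem_spectrum_of_isRoot_charpoly (isRoot_of_mem_roots hz))
    rwa [hM, spectrum.one_eq, Set.mem_singleton_iff] at this
  have hsum : M.trace = M.charpoly.roots.sum := Matrix.trace_eq_sum_roots_charpoly M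
  have hcard : M.charpoly.roots.card = Fintype.card n := by
    rw [← (IsAlgClosed.splits M.charpoly).natDegree_eq_card_roots, Matrix.charpoly_natDegree_eq_dim]
  rw [hsum, ← hcard] at hintegral
  rw [hsum] at h0
  have hone := Multiset.sum_div_card_integral_rootsOfUnity _ k hk hroot hintegral h0
  have heq := Multiset.eq_of_norm_sum_div_card_eq_one _
    (fun z hz => Complex.norm_eq_one_of_pow_eq_one (hroot z hz) hk.ne') hone
  set c := M.charpoly.roots.sum / M.charpoly.roots.card
  have hchar : M.charpoly = (X - C c) ^ Fintype.card n := by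
    rw [(IsAlgClosed.splits M.charpoly).eq_prod_roots_of_monic M.charpoly_monic,
      Multiset.eq_replicate.mpr ⟨hcard, heq⟩]
    simp
  have hpow : minpoly ℂ M ∣ (X - C c) ^ Fintype.card n := hchar ▸ Matrix.minpoly_dvd_charpoly M
  have hsqf : Squarefree (minpoly ℂ M) := by
    refine Squarefree.squarefree_of_dvd hdvd (Separable.squarefree ?_)
    have := separable_X_pow_sub_C (F := ℂ) 1 (n := k) (by exact_mod_cast hk.ne') one_ne_zero
    simpa using this
  have hlin : minpoly ℂ M ∣ X - C c :=
    (hsqf.dvd_pow_iff_dvd Fintype.card_ne_zero).mp hpow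
  refine ⟨c, ?_⟩
  have := aeval_eq_zero_of_dvd_aeval_eq_zero hlin (minpoly.aeval ℂ M)
  rw [map_sub, aeval_X, aeval_C, sub_eq_zero] at this
  rw [this]
  rfl

theorem Matrix.isIntegral_trace_of_pow_eq_one {n : Type*} [Fintype n] [DecidableEq n]
    (M : Matrix n n ℂ) (k : ℕ) (hk : 0 < k) (hM : M ^ k = 1) : IsIntegral ℤ M.trace := by
  rw [Matrix.trace_eq_sum_roots_charpoly]
  refine IsIntegral.multiset_sum fun z hz => ?_
  have := spectrum.pow_mem_pow M k
    (Matrix.mem_spectrum_of_isRoot_charpoly (isRoot_of_mem_roots hz))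
  have hz : z ^ k = 1 := by
    cases isEmpty_or_nonempty n
    · simp at hz
    rwa [hM, spectrum.one_eq, Set.mem_singleton_iff] at this
  exact .of_pow hk (hz ▸ isIntegral_one)

theorem LinearMap.trace_mulLeft_pi_matrix {ι : Type*} [Fintype ι] [DecidableEq ι] (d : ι → ℕ)
    (M : Π i, Matrix (Fin (d i)) (Fin (d i)) ℂ) :
    LinearMap.trace ℂ _ (LinearMap.mulLeft ℂ M) = ∑ i, (d i : ℂ) * (M i).trace := by
  rw [LinearMap.trace_eq_matrix_trace ℂ
      (Pi.basis fun i => Matrix.stdBasis ℂ (Fin (d i)) (Fin (d i))),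
    Matrix.trace, Fintype.sum_sigma]
  refine Finset.sum_congr rfl fun i _ => ?_
  rw [Fintype.sum_prod_type, Matrix.trace, Finset.mul_sum]
  refine Finset.sum_congr rfl fun a _ => ?_
  have : ∀ b : Fin (d i), (LinearMap.toMatrix
      (Pi.basis fun i => Matrix.stdBasis ℂ (Fin (d i)) (Fin (d i)))
      (Pi.basis fun i => Matrix.stdBasis ℂ (Fin (d i)) (Fin (d i)))
      (LinearMap.mulLeft ℂ M)).diag ⟨i, (a, b)⟩ = M i a a := by
    intro b
    rw [Matrix.diag_apply, LinearMap.toMatrix_apply, Pi.basis_repr, Pi.basis_apply,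
      LinearMap.mulLeft_apply, Pi.mul_apply, Pi.single_eq_same, Matrix.stdBasis_eq_single]
    simp [Matrix.stdBasis]
  rw [Finset.sum_congr rfl fun b _ => this b]
  simp

theorem MonoidAlgebra.trace_mulLeft_of {G : Type*} [Group G] [Fintype G] [DecidableEq G] (z : G) :
    LinearMap.trace ℂ _ (LinearMap.mulLeft ℂ (MonoidAlgebra.of ℂ G z))
      = if z = 1 then (Fintype.card G : ℂ) else 0 := by
  rw [LinearMap.trace_eq_matrix_trace ℂ (MonoidAlgebra.basis G ℂ), Matrix.trace]
  have : ∀ g : G, (LinearMap.toMatrix (MonoidAlgebra.basis G ℂ) (MonoidAlgebra.basis G ℂ)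
      (LinearMap.mulLeft ℂ (MonoidAlgebra.of ℂ G z))).diag g = if z = 1 then 1 else 0 := by
    intro g
    rw [Matrix.diag_apply, LinearMap.toMatrix_apply, MonoidAlgebra.basis_apply,
      LinearMap.mulLeft_apply, MonoidAlgebra.of_apply, MonoidAlgebra.single_mul_single]
    simp [MonoidAlgebra.basis, Finsupp.single_apply]
  rw [Finset.sum_congr rfl fun g _ => this g]
  simp

namespace MonoidAlgebra

variable {G : Type*} [Group G]

theorem exists_eq_scalar_of_commute_of {d : ℕ}
    {f : MonoidAlgebra ℂ G →ₐ[ℂ] Matrix (Fin d) (Fin d) ℂ} (hf : Function.Surjective f)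
    {x : MonoidAlgebra ℂ G} (hx : ∀ g : G, Commute (of ℂ G g) x) :
    ∃ c : ℂ, f x = Matrix.scalar (Fin d) c := by
  have hcomm : ∀ y, Commute y x := fun y => by
    induction y using MonoidAlgebra.induction_on with
    | of g => exact hx g
    | add a b ha hb => exact ha.add_left hb
    | smul r a ha => exact ha.smul_left r
  have : f x ∈ Set.range (Matrix.scalar (Fin d)) := by
    rw [Matrix.mem_range_scalar_iff_commute_single']
    intro i j
    obtain ⟨y, hy⟩ := hf (Matrix.single i j 1)
    rw [← hy]
    exact (hcomm y).map f
  obtain ⟨c, hc⟩ := this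
  exact ⟨c, hc.symm⟩

theorem trace_eq_zero_or_scalar_of_coprime [Fintype G] {d : ℕ} [NeZero d]
    {f : MonoidAlgebra ℂ G →ₐ[ℂ] Matrix (Fin d) (Fin d) ℂ} (hf : Function.Surjective f)
    (z : G) (hcop : Nat.Coprime (Nat.card {g : G // IsConj z g}) d) :
    (f (of ℂ G z)).trace = 0 ∨ ∃ c : ℂ, f (of ℂ G z) = Matrix.scalar (Fin d) c := by
  classical
  let T : Finset G := Finset.univ.filter (IsConj z)
  have hT : T.card = Nat.card {g : G // IsConj z g} := by
    rw [Nat.card_eq_fintype_card, Fintype.card_subtype]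
  let κ : MonoidAlgebra ℂ G := ∑ g ∈ T, of ℂ G g
  have hκint : IsIntegral ℤ κ := by
    have h : IsIntegral ℤ (∑ g ∈ T, of ℤ G g) := Algebra.IsIntegral.isIntegral _
    have := h.map (mapRingHom G (Int.castRingHom ℂ)).toIntAlgHom
    convert this
    simp [κ]
  have hκcomm : ∀ h : G, Commute (of ℂ G h) κ := by
    intro h
    change of ℂ G h * κ = κ * of ℂ G h
    simp only [κ, Finset.mul_sum, Finset.sum_mul, ← map_mul]
    refine Finset.sum_bij (fun g _ => h * g * h⁻¹) ?_ ?_ ?_ ?_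
    · intro g hg
      simp only [T, Finset.mem_filter, Finset.mem_univ, true_and] at hg ⊢
      exact hg.trans (isConj_iff.mpr ⟨h, rfl⟩)
    · intro a _ b _ hab
      simpa using hab
    · intro g hg
      simp only [T, Finset.mem_filter, Finset.mem_univ, true_and] at hg
      refine ⟨h⁻¹ * g * h, ?_, by group⟩
      simp only [T, Finset.mem_filter, Finset.mem_univ, true_and]
      exact hg.trans (isConj_iff.mpr ⟨h⁻¹, by group⟩)
    · intro g _
      simp
  obtain ⟨ω, hω⟩ := exists_eq_scalar_of_commute_of hf hκcomm
  have hωint : IsIntegral ℤ ω := by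
    have h : IsIntegral ℤ (f κ) := hκint.map (f.restrictScalars ℤ)
    rw [hω] at h
    exact (isIntegral_algebraMap_iff (A := ℂ) (B := Matrix (Fin d) (Fin d) ℂ)
      (algebraMap ℂ _).injective).mp h
  have htr : (d : ℂ) * ω = T.card * (f (of ℂ G z)).trace := by
    have h := congrArg Matrix.trace hω
    simp only [κ, map_sum, Matrix.trace_sum] at h
    have hconst : ∀ g ∈ T, (f (of ℂ G g)).trace = (f (of ℂ G z)).trace := by
      intro g hg
      simp only [T, Finset.mem_filter, Finset.mem_univ, true_and] at hg
      obtain ⟨c, rfl⟩ := isConj_iff.mp hg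
      rw [map_mul, map_mul, Matrix.trace_mul_comm, ← map_mul, ← map_mul]
      simp
    rw [Finset.sum_congr rfl hconst] at h
    simpa [Matrix.trace, mul_comm] using h.symm
  have hd : (d : ℂ) ≠ 0 := by exact_mod_cast NeZero.ne d
  have hpow : f (of ℂ G z) ^ Fintype.card G = 1 := by
    rw [← map_pow, ← map_pow, pow_card_eq_one, map_one, map_one]
  have hχint := Matrix.isIntegral_trace_of_pow_eq_one _ _ Fintype.card_pos hpow
  refine Matrix.trace_eq_zero_or_scalar _ _ Fintype.card_pos hpow ?_
  rw [← hT] at hcop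
  obtain ⟨u, v, huv⟩ := (Nat.isCoprime_iff_coprime.mpr hcop)
  have : (f (of ℂ G z)).trace / (Fintype.card (Fin d) : ℂ)
      = (u : ℂ) * ω + (v : ℂ) * (f (of ℂ G z)).trace := by
    have huv' : (u : ℂ) * T.card + v * d = 1 := by exact_mod_cast huv
    rw [Fintype.card_fin, div_eq_iff hd]
    linear_combination -(f (of ℂ G z)).trace * huv' - (u : ℂ) * htr
  rw [this]
  exact ((isIntegral_algebraMap (R := ℤ) (x := u)).mul hωint).add
    ((isIntegral_algebraMap (R := ℤ) (x := v)).mul hχint)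

theorem map_sum_of_eq_zero_or_trivial [Fintype G] {d : ℕ}
    {f : MonoidAlgebra ℂ G →ₐ[ℂ] Matrix (Fin d) (Fin d) ℂ} (hf : Function.Surjective f) :
    f (∑ g, of ℂ G g) = 0 ∨ ∀ g, f (of ℂ G g) = 1 := by
  have hl : ∀ h : G, of ℂ G h * ∑ g, of ℂ G g = ∑ g, of ℂ G g := fun h => by
    simp only [Finset.mul_sum, ← map_mul]
    exact Fintype.sum_equiv (Equiv.mulLeft h) _ _ fun _ => rfl
  have hr : ∀ h : G, (∑ g, of ℂ G g) * of ℂ G h = ∑ g, of ℂ G g := fun h => by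
    simp only [Finset.sum_mul, ← map_mul]
    exact Fintype.sum_equiv (Equiv.mulRight h) _ _ fun _ => rfl
  obtain ⟨c, hc⟩ := exists_eq_scalar_of_commute_of hf (x := ∑ g, of ℂ G g)
    fun h => (hl h).trans (hr h).symm
  by_cases hc0 : c = 0
  · left
    rw [hc, hc0, map_zero]
  · right
    intro g
    have h := congrArg f (hl g)
    rw [map_mul, hc] at h
    have := congrArg (fun M => M * Matrix.scalar (Fin d) c⁻¹) h
    simpa [mul_assoc, hc0] using this

end MonoidAlgebra

/-- **Burnside**: an element `z ≠ 1` whose conjugacy class has prime power size is central modulo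
some proper normal subgroup. -/
theorem exists_normal_of_card_conj_eq_prime_pow {G : Type*} [Group G] [Finite G] {z : G}
    (hz : z ≠ 1) {q m : ℕ} (hq : q.Prime) (hcard : Nat.card {g : G // IsConj z g} = q ^ m) :
    ∃ N : Subgroup G, N.Normal ∧ N ≠ ⊤ ∧ ∀ g : G, z * g * z⁻¹ * g⁻¹ ∈ N := by
  classical
  by_contra! hN
  have := Fintype.ofFinite G
  obtain ⟨n, d, hd, ⟨e⟩⟩ :=
    IsSemisimpleRing.exists_algEquiv_pi_matrix_of_isAlgClosed ℂ (MonoidAlgebra ℂ G)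
  let f : ∀ i, MonoidAlgebra ℂ G →ₐ[ℂ] Matrix (Fin (d i)) (Fin (d i)) ℂ := fun i =>
    (Pi.evalAlgHom ℂ (fun i => Matrix (Fin (d i)) (Fin (d i)) ℂ) i).comp e.toAlgHom
  have hf : ∀ i, Function.Surjective (f i) := fun i M =>
    ⟨e.symm (Pi.single i M), by simp [f]⟩
  let E : MonoidAlgebra ℂ G := ∑ g, MonoidAlgebra.of ℂ G g
  let x : MonoidAlgebra ℂ G := (Fintype.card G : ℂ) • MonoidAlgebra.of ℂ G z - E
  have htrace : ∑ i, (d i : ℂ) * (f i x).trace = -(Fintype.card G : ℂ) := by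
    have h1 : LinearMap.trace ℂ _ (LinearMap.mulLeft ℂ (e x))
        = LinearMap.trace ℂ _ (LinearMap.mulLeft ℂ x) := by
      rw [← LinearMap.trace_conj' (LinearMap.mulLeft ℂ x) e.toLinearEquiv]
      congr 1
      refine LinearMap.ext fun y => ?_
      simp [LinearEquiv.conj_apply]
    have h2 : LinearMap.trace ℂ _ (LinearMap.mulLeft ℂ x) = -(Fintype.card G : ℂ) := by
      have : LinearMap.mulLeft ℂ x = (Fintype.card G : ℂ) •
          LinearMap.mulLeft ℂ (MonoidAlgebra.of ℂ G z)
          - ∑ g, LinearMap.mulLeft ℂ (MonoidAlgebra.of ℂ G g) := by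
        refine LinearMap.ext fun y => ?_
        simp only [x, E, LinearMap.mulLeft_apply, LinearMap.sub_apply, LinearMap.smul_apply,
          LinearMap.sum_apply, sub_mul, Finset.sum_mul, smul_mul_assoc]
      rw [this, map_sub, map_smul, map_sum]
      simp only [MonoidAlgebra.trace_mulLeft_of]
      simp [hz]
    rw [← h2, ← h1, LinearMap.trace_mulLeft_pi_matrix]
    rfl
  have hterm : ∀ i, ∃ a : ℂ, IsIntegral ℤ a ∧
      (d i : ℂ) * (f i x).trace = (Fintype.card G : ℂ) * (q * a) := by
    intro i
    by_cases htriv : ∀ g, f i (MonoidAlgebra.of ℂ G g) = 1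
    · refine ⟨0, isIntegral_zero, ?_⟩
      have : f i x = 0 := by
        simp only [x, E, map_sub, map_smul, map_sum, htriv]
        simp [← Nat.cast_smul_eq_nsmul ℂ]
      simp [this]
    have hE := (MonoidAlgebra.map_sum_of_eq_zero_or_trivial (hf i)).resolve_right htriv
    have hx : f i x = (Fintype.card G : ℂ) • f i (MonoidAlgebra.of ℂ G z) := by
      simp only [x, E, map_sub, map_smul, hE, sub_zero]
    rw [hx, Matrix.trace_smul, smul_eq_mul]
    by_cases hqd : q ∣ d i
    · obtain ⟨k, hk⟩ := hqd
      refine ⟨k * (f i (MonoidAlgebra.of ℂ G z)).trace, ?_, ?_⟩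
      · refine (isIntegral_natCast k).mul
          (Matrix.isIntegral_trace_of_pow_eq_one _ (Fintype.card G) Fintype.card_pos ?_)
        rw [← map_pow, ← map_pow, pow_card_eq_one, map_one, map_one]
      · have hk' : (d i : ℂ) = q * k := by exact_mod_cast hk
        rw [hk']
        ring
    have := hd i
    rcases MonoidAlgebra.trace_eq_zero_or_scalar_of_coprime (hf i) z
      (hcard ▸ Nat.Coprime.pow_left m ((Nat.Prime.coprime_iff_not_dvd hq).mpr hqd)) with h | ⟨c, hc⟩
    · exact ⟨0, isIntegral_zero, by rw [h]; simp⟩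
    · exfalso
      let ρ : G →* Matrix (Fin (d i)) (Fin (d i)) ℂ :=
        ((f i : MonoidAlgebra ℂ G →* Matrix (Fin (d i)) (Fin (d i)) ℂ)).comp (MonoidAlgebra.of ℂ G)
      have hker : ρ.ker ≠ ⊤ := fun h => htriv fun g => by
        have : g ∈ ρ.ker := h ▸ Subgroup.mem_top g
        exact this
      obtain ⟨g, hg⟩ := hN ρ.ker inferInstance hker
      refine hg ?_
      have hcomm : ρ z * ρ g = ρ g * ρ z := by
        have hz : ρ z = Matrix.scalar (Fin (d i)) c := hc
        rw [hz]
        exact Matrix.scalar_commute c (fun _ => Commute.all _ _) (ρ g)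
      rw [MonoidHom.mem_ker, map_mul, map_mul, map_mul, hcomm, mul_assoc (ρ g), ← map_mul,
        mul_inv_cancel,
        map_one, mul_one, ← map_mul, mul_inv_cancel, map_one]
  choose a haint ha using hterm
  rw [Finset.sum_congr rfl fun i _ => ha i, ← Finset.mul_sum, ← Finset.mul_sum] at htrace
  have hG : (Fintype.card G : ℂ) ≠ 0 := by exact_mod_cast Fintype.card_ne_zero
  have hq1 : (q : ℂ) * ∑ i, a i = -1 := by
    apply mul_left_cancel₀ hG
    rw [htrace, mul_neg_one]
  have hqint : IsIntegral ℤ ((algebraMap ℚ ℂ) (q : ℚ)⁻¹) := by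
    have : (algebraMap ℚ ℂ) (q : ℚ)⁻¹ = -∑ i, a i := by
      have hq0 : (q : ℂ) ≠ 0 := by exact_mod_cast hq.ne_zero
      simp only [map_inv₀, map_natCast]
      field_simp
      linear_combination hq1
    rw [this]
    exact (IsIntegral.sum _ fun i _ => haint i).neg
  rw [isIntegral_algebraMap_iff (algebraMap ℚ ℂ).injective] at hqint
  obtain ⟨k, hk⟩ := IsIntegrallyClosed.isIntegral_iff.mp hqint
  have hkq : k * q = 1 := by
    have hq0 : (q : ℚ) ≠ 0 := by exact_mod_cast hq.ne_zero
    have : (k : ℚ) * q = 1 := by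
      rw [show (k : ℚ) = (q : ℚ)⁻¹ from hk, inv_mul_cancel₀ hq0]
    exact_mod_cast this
  have : (q : ℤ) ∣ 1 := ⟨k, by rw [← hkq, mul_comm]⟩
  exact hq.one_lt.ne' (by exact_mod_cast Int.eq_one_of_dvd_one (by positivity) this)

end Burnside

theorem Nat.card_isConj_eq_index_centralizer {G : Type*} [Group G] (z : G) :
    Nat.card {g : G // IsConj z g} = (Subgroup.centralizer {z}).index := by
  have h : (Subgroup.centralizer {z} : Subgroup G).index =
      (MulAction.stabilizer (ConjAct G) z).index := by
    rw [Subgroup.centralizer_eq_comap_stabilizer]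
    exact Subgroup.index_comap_of_surjective _ (MulEquiv.surjective _)
  rw [h, MulAction.index_stabilizer, ← Nat.card_coe_set_eq]
  exact Nat.card_congr (Equiv.subtypeEquivRight fun g => by
    rw [ConjAct.mem_orbit_conjAct, isConj_comm])

/-- Burnside's theorem: a finite group whose order has at most two prime divisors is solvable. -/
theorem Group.isSolvable_of_card_two_primes {p q : ℕ} {G : Type*} [Group G] [Finite G]
    (hG : ∀ r : ℕ, r.Prime → r ∣ Nat.card G → r = p ∨ r = q) : Group.IsSolvable G := by
  induction hn : Nat.card G using Nat.strong_induction_on generalizing G with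
  | _ n ih =>
  subst hn
  by_cases hN : ∃ N : Subgroup G, N.Normal ∧ N ≠ ⊥ ∧ N ≠ ⊤
  · obtain ⟨N, hNn, hb, ht⟩ := hN
    rw [Group.isSolvable_iff_subgroup_quotient N]
    have hmul : Nat.card N * N.index = Nat.card G := N.card_mul_index
    refine ⟨ih _ ?_ (fun r hr h => hG r hr (h.trans N.card_subgroup_dvd_card)) rfl,
      ih _ ?_ (fun r hr h => hG r hr (h.trans N.card_quotient_dvd_card)) rfl⟩
    · exact lt_of_le_of_ne (Subgroup.card_le_card_group N)
        fun h => ht (Subgroup.eq_top_of_card_eq N h)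
    · refine lt_of_le_of_ne (Nat.le_of_dvd Nat.card_pos N.card_quotient_dvd_card) fun h => hb ?_
      rw [← Subgroup.card_eq_one]
      have : N.index = Nat.card G := h
      rw [this] at hmul
      exact (Nat.mul_eq_right Nat.card_pos.ne').mp hmul
  · push Not at hN
    rcases subsingleton_or_nontrivial G with hs | hs
    · exact Group.isSolvable_of_comm fun a b => Subsingleton.elim _ _
    obtain ⟨r, hr, hrd⟩ := Nat.exists_prime_and_dvd (Finite.one_lt_card (α := G)).ne'
    have : Fact r.Prime := ⟨hr⟩
    obtain ⟨R⟩ : Nonempty (Sylow r G) := inferInstance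
    have hRn : Nontrivial R := by
      rw [← Finite.one_lt_card_iff_nontrivial]
      exact lt_of_lt_of_le hr.one_lt (Nat.le_of_dvd Nat.card_pos (R.dvd_card_of_dvd_card hrd))
    have hc := R.isPGroup'.center_nontrivial
    obtain ⟨⟨z, hzc⟩, hz1⟩ := exists_ne (1 : Subgroup.center R)
    have hz : (z : G) ≠ 1 := fun h => hz1 (by ext; exact h)
    have hle : (R : Subgroup G) ≤ Subgroup.centralizer {(z : G)} := by
      intro g hg
      rw [Subgroup.mem_centralizer_singleton_iff]
      exact congrArg Subtype.val (Subgroup.mem_center_iff.mp hzc ⟨g, hg⟩)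
    have hidx := Subgroup.index_dvd_of_le hle
    obtain ⟨s, hs, hs'⟩ : ∃ s : ℕ, s.Prime ∧ ∀ {d : ℕ}, d.Prime →
        d ∣ (Subgroup.centralizer {(z : G)}).index → d = s := by
      by_cases h : ∃ s : ℕ, s.Prime ∧ s ∣ (Subgroup.centralizer {(z : G)}).index
      · obtain ⟨s, hs, hsd⟩ := h
        refine ⟨s, hs, fun {d} hd hdd => ?_⟩
        have aux : ∀ {t : ℕ}, t ∣ (Subgroup.centralizer {(z : G)}).index → t ≠ r ∧ t ∣ Nat.card G :=
          fun {t} ht => ⟨fun e => R.not_dvd_index ((dvd_of_eq e.symm).trans (ht.trans hidx)),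
            ht.trans (Subgroup.index_dvd_card _)⟩
        have h1 := hG r hr hrd
        have h2 := hG s hs (aux hsd).2
        have h3 := hG d hd (aux hdd).2
        have h4 := (aux hsd).1
        have h5 := (aux hdd).1
        grind
      · exact ⟨r, hr, fun hd hdd => (h ⟨_, hd, hdd⟩).elim⟩
    have hcard := Nat.eq_prime_pow_of_unique_prime_dvd Subgroup.index_ne_zero_of_finite hs'
    rw [← Nat.card_isConj_eq_index_centralizer] at hcard
    obtain ⟨N, hNn, hNt, hN'⟩ := exists_normal_of_card_conj_eq_prime_pow hz hs hcard
    have hNb : N = ⊥ := by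
      by_contra h
      exact hNt (hN N hNn h)
    have hzcen : (z : G) ∈ Subgroup.center G := by
      rw [Subgroup.mem_center_iff]
      intro g
      have := hN' g
      rw [hNb, Subgroup.mem_bot, mul_inv_eq_one, mul_inv_eq_iff_eq_mul] at this
      exact this.symm
    have htop := hN (Subgroup.center G) inferInstance fun h => hz (by
      rwa [h, Subgroup.mem_bot] at hzcen)
    refine Group.isSolvable_of_comm fun a b => ?_
    have : b ∈ Subgroup.center G := htop ▸ Subgroup.mem_top b
    exact Subgroup.mem_center_iff.mp this a

/-- A nontrivial normal subgroup of a finite solvable group contains a nontrivial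
normal elementary abelian subgroup. -/
theorem Subgroup.exists_normal_elementary_le {G : Type*} [Group G] [Finite G] [Group.IsSolvable G]
    (N : Subgroup G) (hNn : N.Normal) (hN : N ≠ ⊥) :
    ∃ p : ℕ, p.Prime ∧ ∃ M : Subgroup G, M.Normal ∧ M ≤ N ∧ M ≠ ⊥ ∧
      (∀ a ∈ M, ∀ b ∈ M, a * b = b * a) ∧ ∀ a ∈ M, a ^ p = 1 := by
  induction N using WellFoundedLT.induction with
  | ind N ih =>
  by_cases hc : ⁅N, N⁆ = ⊥
  · have hcomm : ∀ a ∈ N, ∀ b ∈ N, a * b = b * a := fun a ha b hb => by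
      rw [← commutatorElement_eq_one_iff_mul_comm, ← Subgroup.mem_bot, ← hc]
      exact Subgroup.commutator_mem_commutator ha hb
    have : Nontrivial N := (Subgroup.nontrivial_iff_ne_bot N).mpr hN
    obtain ⟨p, hp, hpd⟩ := Nat.exists_prime_and_dvd (Finite.one_lt_card (α := N)).ne'
    have : Fact p.Prime := ⟨hp⟩
    obtain ⟨x, hx⟩ := exists_prime_orderOf_dvd_card' p hpd
    refine ⟨p, hp,
      { carrier := {a | a ∈ N ∧ a ^ p = 1}
        one_mem' := ⟨N.one_mem, one_pow _⟩
        mul_mem' := fun {a b} ha hb => ⟨N.mul_mem ha.1 hb.1, by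
          rw [Commute.mul_pow (hcomm a ha.1 b hb.1), ha.2, hb.2, one_mul]⟩
        inv_mem' := fun {a} ha => ⟨N.inv_mem ha.1, by rw [inv_pow, ha.2, inv_one]⟩ },
      ⟨fun a ha g => ⟨hNn.conj_mem a ha.1 g, by
        rw [conj_pow, ha.2, mul_one, mul_inv_cancel]⟩⟩, fun a ha => ha.1, ?_,
      fun a ha b hb => hcomm a ha.1 b hb.1, fun a ha => ha.2⟩
    rw [Subgroup.ne_bot_iff_exists_ne_one]
    refine ⟨⟨x, x.2, ?_⟩, fun h => ?_⟩
    · exact_mod_cast congrArg Subtype.val (hx ▸ pow_orderOf_eq_one x)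
    · have h1 : x = 1 := by
        have h' := Subtype.ext_iff.mp h
        exact Subtype.ext h'
      rw [h1, orderOf_one] at hx
      exact hp.one_lt.ne hx
  · have hlt := Group.IsSolvable.commutator_lt_of_ne_bot hN
    obtain ⟨p, hp, M, hM, hMle, h⟩ := ih _ hlt inferInstance hc
    exact ⟨p, hp, M, hM, hMle.trans hlt.le, h⟩

theorem Subgroup.exists_smul_eq_of_coprime_index {G : Type*} [Group G] [Finite G]
    {H K : Subgroup G} (h : H.index.Coprime K.index) (x y : G ⧸ K) : ∃ a ∈ H, a • x = y := by
  set S := MulAction.stabilizer G x with hS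
  have hSK : S.index = Nat.card (G ⧸ K) := MulAction.index_stabilizer_of_transitive G x
  have horb : S.relIndex H = (MulAction.orbit H x).ncard := by
    rw [← MulAction.index_stabilizer]
    rfl
  have hdvd : S.index ∣ S.relIndex H * H.index := by
    rw [← Subgroup.inf_relIndex_right, Subgroup.relIndex_mul_index inf_le_right]
    exact Subgroup.index_dvd_of_le inf_le_left
  have hcop : S.index.Coprime H.index := by
    rw [hSK]
    exact h.symm
  have hd := hcop.dvd_of_dvd_mul_right hdvd
  have huniv : MulAction.orbit H x = Set.univ := by
    apply Set.eq_of_subset_of_ncard_le (Set.subset_univ _)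
    rw [Set.ncard_univ, ← hSK, ← horb]
    refine Nat.le_of_dvd ?_ hd
    rw [horb, Set.ncard_pos]
    exact MulAction.nonempty_orbit x
  obtain ⟨a, ha⟩ : y ∈ MulAction.orbit H x := huniv ▸ Set.mem_univ y
  exact ⟨a, a.2, ha⟩

theorem Subgroup.exists_normalClosure_le_conj {G : Type*} [Group G] [Finite G]
    {H K M : Subgroup G} (h : H.index.Coprime K.index)
    (hM : ∀ a ∈ H, ∀ m ∈ M, a * m * a⁻¹ ∈ M) {p : ℕ} [Fact p.Prime] (hMp : IsPGroup p M)
    (hpK : ¬ p ∣ K.index) :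
    ∃ g : G, Subgroup.normalClosure (M : Set G) ≤ K.map (MulAut.conj g).toMonoidHom := by
  obtain ⟨x, hx⟩ := hMp.nonempty_fixed_point_of_prime_not_dvd_card (G ⧸ K) hpK
  obtain ⟨g, rfl⟩ := QuotientGroup.mk_surjective x
  refine ⟨g, (Subgroup.closure_le _).mpr fun y hy => ?_⟩
  obtain ⟨m, hm, hmy⟩ := Group.mem_conjugatesOfSet_iff.mp hy
  obtain ⟨c, rfl⟩ := isConj_iff.mp hmy
  obtain ⟨a, ha, hac⟩ := exists_smul_eq_of_coprime_index h (QuotientGroup.mk g)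
    (c⁻¹ • (QuotientGroup.mk g : G ⧸ K))
  have hfix := hx ⟨a⁻¹ * m * a, by simpa using hM a⁻¹ (H.inv_mem ha) m hm⟩
  have hfix' : (a⁻¹ * m * a) • (QuotientGroup.mk g : G ⧸ K) = QuotientGroup.mk g := hfix
  have key : (c * m * c⁻¹) • (QuotientGroup.mk g : G ⧸ K) = QuotientGroup.mk g := by
    rw [mul_smul, ← hac, ← mul_smul, mul_assoc, mul_smul,
      show m * a = a * (a⁻¹ * m * a) by group, mul_smul, hfix', hac, smul_inv_smul]
  rw [SetLike.mem_coe, Subgroup.mem_map_equiv, MulAut.conj_symm_apply]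
  have := QuotientGroup.eq.mp key.symm
  simpa [mul_assoc] using this

/-- Wielandt's theorem: a finite group with three solvable subgroups of pairwise coprime
indices is solvable. -/
theorem Group.isSolvable_of_three_coprime_index {G : Type*} [Group G] [Finite G]
    (H K L : Subgroup G) [Group.IsSolvable H] [Group.IsSolvable K] [Group.IsSolvable L]
    (hHK : H.index.Coprime K.index) (hHL : H.index.Coprime L.index)
    (hKL : K.index.Coprime L.index) : Group.IsSolvable G := by
  induction hn : Nat.card G using Nat.strong_induction_on generalizing G with
  | _ n ih =>
  subst hn
  by_cases hH : H = ⊥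
  · subst hH
    rw [Subgroup.index_bot] at hHK
    have : K = ⊤ := Subgroup.index_eq_one.mp
      (Nat.Coprime.eq_one_of_dvd hHK.symm K.index_dvd_card)
    subst this
    exact Group.isSolvable_of_surjective (f := (⊤ : Subgroup G).subtype) fun x =>
      ⟨⟨x, trivial⟩, rfl⟩
  have : Nontrivial H := (Subgroup.nontrivial_iff_ne_bot H).mpr hH
  have hHs : Group.IsSolvable H := ‹_›
  obtain ⟨p, hp, M, hMn, -, hMb, -, hMp⟩ :=
    Subgroup.exists_normal_elementary_le (⊤ : Subgroup H) inferInstance top_ne_bot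
  have : Fact p.Prime := ⟨hp⟩
  have hMG : IsPGroup p (M.map H.subtype) :=
    IsPGroup.map (fun a => ⟨1, by ext; simpa using congrArg (fun x : H => (x : G)) (hMp a a.2)⟩) _
  have hMnorm : ∀ a ∈ H, ∀ m ∈ M.map H.subtype, a * m * a⁻¹ ∈ M.map H.subtype := by
    rintro a ha _ ⟨m, hm, rfl⟩
    exact ⟨_, hMn.conj_mem m hm ⟨a, ha⟩, rfl⟩
  obtain ⟨T, hTn, hMT, hT⟩ : ∃ T : Subgroup G, T.Normal ∧ M.map H.subtype ≤ T ∧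
      Group.IsSolvable T := by
    have aux : ∀ K : Subgroup G, Group.IsSolvable K → H.index.Coprime K.index → ¬ p ∣ K.index →
        ∃ T : Subgroup G, T.Normal ∧ M.map H.subtype ≤ T ∧ Group.IsSolvable T := by
      intro K hK hHK hpK
      obtain ⟨g, hg⟩ := Subgroup.exists_normalClosure_le_conj hHK hMnorm hMG hpK
      have : Group.IsSolvable (K.map (MulAut.conj g).toMonoidHom) :=
        Group.isSolvable_of_surjective (MonoidHom.subgroupMap_surjective _ K)
      exact ⟨_, Subgroup.normalClosure_normal, Subgroup.subset_normalClosure,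
        Group.isSolvable_of_isSolvable_injective (Subgroup.inclusion_injective hg)⟩
    by_cases hpK : p ∣ K.index
    · exact aux L ‹_› hHL fun hpL => Nat.not_coprime_of_dvd_of_dvd hp.one_lt hpK hpL hKL
    · exact aux K ‹_› hHK hpK
  have hTb : T ≠ ⊥ := by
    rintro rfl
    exact hMb ((Subgroup.map_eq_bot_iff_of_injective _ H.subtype_injective).mp (le_bot_iff.mp hMT))
  have hd : ∀ S : Subgroup G, (S.map (QuotientGroup.mk' T)).index ∣ S.index := fun S =>
    Subgroup.index_map_dvd _ (QuotientGroup.mk'_surjective T)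
  have hsol : ∀ S : Subgroup G, Group.IsSolvable S →
      Group.IsSolvable (S.map (QuotientGroup.mk' T)) := fun S _ =>
    Group.isSolvable_of_surjective (MonoidHom.subgroupMap_surjective _ S)
  have := hsol H ‹_›
  have := hsol K ‹_›
  have := hsol L ‹_›
  rw [Group.isSolvable_iff_subgroup_quotient T]
  refine ⟨hT, ih _ ?_ (H.map (QuotientGroup.mk' T)) (K.map (QuotientGroup.mk' T))
    (L.map (QuotientGroup.mk' T)) (hHK.of_dvd (hd _) (hd _)) (hHL.of_dvd (hd _) (hd _))
    (hKL.of_dvd (hd _) (hd _)) rfl⟩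
  have hmul : Nat.card T * Nat.card (G ⧸ T) = Nat.card G := T.card_mul_index
  have h1 : 1 < Nat.card T := Subgroup.one_lt_card_iff_ne_bot T |>.mpr hTb
  rw [← hmul]
  exact lt_mul_of_one_lt_left Nat.card_pos h1

theorem Nat.Coprime.card_of_forall_pow_eq_one {A : Type*} [Group A] [Finite A] {u v : ℕ}
    (huv : u.Coprime v) (h : ∀ a : A, a ^ v = 1) : u.Coprime (Nat.card A) := by
  refine Nat.Coprime.symm (Nat.coprime_of_dvd fun r hr hrA hru => ?_)
  have : Fact r.Prime := ⟨hr⟩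
  obtain ⟨a, ha⟩ := exists_prime_orderOf_dvd_card' r hrA
  exact Nat.not_coprime_of_dvd_of_dvd hr.one_lt hru (ha ▸ orderOf_dvd_of_pow_eq_one (h a)) huv

theorem card_ker_powMonoidHom_of_coprime {A : Type*} [CommGroup A] [Finite A] {u v : ℕ}
    (huv : u.Coprime v) (hA : Nat.card A = u * v) :
    Nat.card (powMonoidHom v : A →* A).ker = v := by
  have hmul : Nat.card (powMonoidHom v : A →* A).ker * Nat.card (powMonoidHom v : A →* A).range =
      u * v := by
    rw [← hA, ← Subgroup.index_ker, Subgroup.card_mul_index]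
  have hK : u.Coprime (Nat.card (powMonoidHom v : A →* A).ker) :=
    huv.card_of_forall_pow_eq_one fun a => Subtype.ext a.2
  have hR : v.Coprime (Nat.card (powMonoidHom v : A →* A).range) := by
    refine huv.symm.card_of_forall_pow_eq_one ?_
    rintro ⟨_, x, rfl⟩
    ext
    simp [← pow_mul, mul_comm v u, ← hA]
  apply Nat.dvd_antisymm
  · exact hK.symm.dvd_of_dvd_mul_left (hmul ▸ dvd_mul_right _ _)
  · exact hR.dvd_of_dvd_mul_right (hmul ▸ dvd_mul_left _ _)

section Cocycle

variable {G A : Type*} [Group G] [CommGroup A]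

theorem cocycle_one {φ : G →* MulAut A} {β : G ≃ A} (hβ : ∀ g h, β (g * h) = β g * φ g (β h)) :
    β 1 = 1 := by
  have h := hβ 1 1
  rwa [mul_one, map_one φ, MulAut.one_apply, left_eq_mul] at h

/-- The preimage of an invariant subgroup under a bijective `1`-cocycle. -/
def cocyclePreimage (φ : G →* MulAut A) (β : G ≃ A) (hβ : ∀ g h, β (g * h) = β g * φ g (β h))
    (J : Subgroup A) (hJ : ∀ g, ∀ a ∈ J, φ g a ∈ J) : Subgroup G where
  carrier := {g | β g ∈ J}
  mul_mem' {g h} hg hh := by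
    rw [Set.mem_ofPred_eq, hβ]
    exact J.mul_mem hg (hJ g _ hh)
  one_mem' := by
    rw [Set.mem_ofPred_eq, cocycle_one hβ]
    exact J.one_mem
  inv_mem' {g} hg := by
    have h := hβ g⁻¹ g
    rw [inv_mul_cancel, cocycle_one hβ] at h
    rw [Set.mem_ofPred_eq, eq_inv_of_mul_eq_one_left h.symm]
    exact J.inv_mem (hJ _ _ hg)

variable {φ : G →* MulAut A} {β : G ≃ A}

@[simp]
theorem mem_cocyclePreimage (hβ : ∀ g h, β (g * h) = β g * φ g (β h)) {J : Subgroup A}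
    {hJ : ∀ g, ∀ a ∈ J, φ g a ∈ J} {g : G} :
    g ∈ cocyclePreimage φ β hβ J hJ ↔ β g ∈ J :=
  Iff.rfl

theorem card_cocyclePreimage (hβ : ∀ g h, β (g * h) = β g * φ g (β h))
    {J : Subgroup A} (hJ : ∀ g, ∀ a ∈ J, φ g a ∈ J) :
    Nat.card (cocyclePreimage φ β hβ J hJ) = Nat.card J :=
  Nat.card_congr (β.subtypeEquiv fun _ => Iff.rfl)

theorem isSolvable_cocyclePreimage [Finite G] (hβ : ∀ g h, β (g * h) = β g * φ g (β h))
    (J : Subgroup A) (hJ : ∀ g, ∀ a ∈ J, φ g a ∈ J) :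
    Group.IsSolvable (cocyclePreimage φ β hβ J hJ) := by
  have : Finite A := Finite.of_equiv G β
  induction hn : Nat.card J using Nat.strong_induction_on generalizing J with
  | _ n ih =>
  subst hn
  by_cases h2 : ∃ p q : ℕ, ∀ r : ℕ, r.Prime → r ∣ Nat.card J → r = p ∨ r = q
  · obtain ⟨p, q, h⟩ := h2
    exact Group.isSolvable_of_card_two_primes (p := p) (q := q) (by rwa [card_cocyclePreimage])
  push Not at h2
  have key : ∀ s : ℕ, s.Prime → s ∣ Nat.card J →
      ∃ H : Subgroup (cocyclePreimage φ β hβ J hJ), Group.IsSolvable H ∧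
        ∃ k, H.index = s ^ k := by
    intro s hs hsd
    set m := ordCompl[s] (Nat.card J) with hm
    have hmul : ordProj[s] (Nat.card J) * m = Nat.card J := Nat.ordProj_mul_ordCompl_eq_self _ _
    have hcop : (ordProj[s] (Nat.card J)).Coprime m :=
      (Nat.coprime_ordCompl hs Nat.card_pos.ne').pow_left _
    set J' : Subgroup A := (powMonoidHom m : J →* J).ker.map J.subtype with hJ'
    have hJ'card : Nat.card J' = m := by
      rw [hJ', Subgroup.card_map_of_injective J.subtype_injective]
      exact card_ker_powMonoidHom_of_coprime hcop hmul.symm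
    have hJ'le : J' ≤ J := Subgroup.map_subtype_le _
    have hmem : ∀ a, a ∈ J' ↔ a ∈ J ∧ a ^ m = 1 := by
      intro a
      constructor
      · rintro ⟨b, hb, rfl⟩
        exact ⟨b.2, congrArg Subtype.val hb⟩
      · rintro ⟨ha, ham⟩
        exact ⟨⟨a, ha⟩, Subtype.ext ham, rfl⟩
    have hJ'inv : ∀ g, ∀ a ∈ J', φ g a ∈ J' := by
      intro g a ha
      rw [hmem] at ha ⊢
      exact ⟨hJ g a ha.1, by rw [← map_pow, ha.2, map_one]⟩
    have hle : cocyclePreimage φ β hβ J' hJ'inv ≤ cocyclePreimage φ β hβ J hJ :=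
      fun g hg => hJ'le hg
    have hsol : Group.IsSolvable (cocyclePreimage φ β hβ J' hJ'inv) := by
      refine ih _ ?_ J' hJ'inv rfl
      rw [hJ'card]
      refine lt_of_le_of_ne (Nat.le_of_dvd Nat.card_pos (hmul ▸ dvd_mul_left _ _)) fun h => ?_
      exact Nat.not_dvd_ordCompl hs Nat.card_pos.ne' (hm ▸ h ▸ hsd)
    let e := Subgroup.subgroupOfEquivOfLe hle
    refine ⟨(cocyclePreimage φ β hβ J' hJ'inv).subgroupOf _,
      Group.isSolvable_of_isSolvable_injective (f := e.toMonoidHom) e.injective,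
      (Nat.card J).factorization s, ?_⟩
    have h := ((cocyclePreimage φ β hβ J' hJ'inv).subgroupOf
      (cocyclePreimage φ β hβ J hJ)).card_mul_index
    rw [Nat.card_congr e.toEquiv, card_cocyclePreimage, card_cocyclePreimage, hJ'card, ← hmul,
      mul_comm] at h
    exact Nat.eq_of_mul_eq_mul_right (hJ'card ▸ Nat.card_pos) h
  obtain ⟨p, hp, hpd, -⟩ := h2 0 0
  obtain ⟨q, hq, hqd, hqp, -⟩ := h2 p p
  obtain ⟨r, hr, hrd, hrp, hrq⟩ := h2 p q
  obtain ⟨H, hH, k, hk⟩ := key p hp hpd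
  obtain ⟨K, hK, l, hl⟩ := key q hq hqd
  obtain ⟨L, hL, t, ht⟩ := key r hr hrd
  refine Group.isSolvable_of_three_coprime_index H K L ?_ ?_ ?_
  · rw [hk, hl]
    exact Nat.coprime_pow_primes _ _ hp hq hqp.symm
  · rw [hk, ht]
    exact Nat.coprime_pow_primes _ _ hp hr hrp.symm
  · rw [hl, ht]
    exact Nat.coprime_pow_primes _ _ hq hr hrq.symm

/-- A finite group with a bijective `1`-cocycle to an abelian group is solvable. -/
theorem Group.isSolvable_of_bijective_cocycle [Finite G]
    (hβ : ∀ g h, β (g * h) = β g * φ g (β h)) : Group.IsSolvable G := by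
  have := isSolvable_cocyclePreimage hβ ⊤ fun _ _ _ => Subgroup.mem_top _
  exact Group.isSolvable_of_isSolvable_injective
    (f := (MonoidHom.id G).codRestrict (cocyclePreimage φ β hβ ⊤ fun _ _ _ => Subgroup.mem_top _)
      fun g => Subgroup.mem_top (β g)) fun a b h => congrArg Subtype.val h

theorem div_mem_of_normal_le_cocyclePreimage (hβ : ∀ g h, β (g * h) = β g * φ g (β h))
    {J : Subgroup A} (hJ : ∀ g, ∀ a ∈ J, φ g a ∈ J) {N : Subgroup G} (hN : N.Normal)
    (hNJ : N ≤ cocyclePreimage φ β hβ J hJ) {v : G} (hv : v ∈ N) (b : A) : φ v b / b ∈ J := by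
  obtain ⟨g, rfl⟩ := β.surjective b
  have hv' : g⁻¹ * v * g ∈ N := by simpa using hN.conj_mem v hv g⁻¹
  have h : β v * φ v (β g) = β g * φ g (β (g⁻¹ * v * g)) := by
    rw [← hβ, ← hβ]
    congr 1
    group
  have h' : φ v (β g) / β g = φ g (β (g⁻¹ * v * g)) / β v := by
    rw [div_eq_div_iff_mul_eq_mul, mul_comm, h, mul_comm]
  rw [h']
  exact J.div_mem (hJ _ _ (hNJ hv')) (hNJ hv)

theorem cocyclePreimage_normal (hβ : ∀ g h, β (g * h) = β g * φ g (β h))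
    {J : Subgroup A} (hJ : ∀ g, ∀ a ∈ J, φ g a ∈ J) (h : ∀ g b, φ g b / b ∈ J) :
    (cocyclePreimage φ β hβ J hJ).Normal := by
  refine ⟨fun k hk g => ?_⟩
  have hmul : β (g * k * g⁻¹) * φ (g * k * g⁻¹) (β g) = β g * φ g (β k) := by
    rw [← hβ, ← hβ, inv_mul_cancel_right]
  have heq : β (g * k * g⁻¹) = φ g (β k) / (φ (g * k * g⁻¹) (β g) / β g) := by
    rw [eq_div_iff_mul_eq', mul_div_assoc', hmul, mul_div_cancel_left]
  rw [mem_cocyclePreimage, heq]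
  exact J.div_mem (hJ _ _ hk) (h _ _)

theorem IsPGroup.exists_ne_one_fixed {P B : Type*} [Group P] [Group B] [Finite B] {p : ℕ}
    [Fact p.Prime] (hP : IsPGroup p P) (f : P →* MulAut B) (J : Subgroup B)
    (hJ : ∀ g, ∀ b ∈ J, f g b ∈ J) (hp : p ∣ Nat.card J) :
    ∃ b ∈ J, b ≠ 1 ∧ ∀ g, f g b = b := by
  let _ : MulAction P J :=
    { smul := fun g b => ⟨f g b, hJ g b b.2⟩
      one_smul := fun b => Subtype.ext (by
        change f 1 (b : B) = b
        rw [map_one, MulAut.one_apply])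
      mul_smul := fun g h b => Subtype.ext (by
        change f (g * h) (b : B) = f g (f h b)
        rw [map_mul, MulAut.mul_apply]) }
  obtain ⟨b, hb, hb1⟩ := hP.exists_fixed_point_of_prime_dvd_card_of_fixed_point J hp (a := 1)
    fun g => Subtype.ext (map_one (f g))
  exact ⟨b, b.2, fun h => hb1 (Subtype.ext h.symm), fun g => congrArg Subtype.val (hb g)⟩

theorem eq_of_commute_of_smul_eq {G X : Type*} [Group G] [MulAction G X] [FaithfulSMul G X]
    {N : Subgroup G} (hN : ∀ x y : X, ∃ g ∈ N, g • x = y) {g h : G}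
    (hg : ∀ v ∈ N, g * v = v * g) (hh : ∀ v ∈ N, h * v = v * h) {x : X} (hx : g • x = h • x) :
    g = h := by
  refine FaithfulSMul.eq_of_smul_eq_smul (α := X) fun y => ?_
  obtain ⟨v, hv, rfl⟩ := hN x y
  rw [← mul_smul, ← mul_smul, hg v hv, hh v hv, mul_smul, mul_smul, hx]

theorem cocycle_const_of_innatelyTransitive {X : Type*} [Finite G] [MulAction G X]
    [FaithfulSMul G X] (hβ : ∀ g h, β (g * h) = β g * φ g (β h)) {a : X → A}
    (ha : ∀ g x, φ g (a x) = a (g • x)) (hgen : Subgroup.closure (Set.range a) = ⊤)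
    {N : Subgroup G} (hNn : N.Normal) (hNb : N ≠ ⊥)
    (hmin : ∀ M : Subgroup G, M.Normal → M ≤ N → M = ⊥ ∨ M = N)
    (htrans : ∀ x y : X, ∃ g ∈ N, g • x = y) (x y : X) : a x = a y := by
  have : Finite A := Finite.of_equiv G β
  have := Group.isSolvable_of_bijective_cocycle hβ
  have hcomm_exp : ∃ p : ℕ, p.Prime ∧ (∀ a ∈ N, ∀ b ∈ N, a * b = b * a) ∧
      ∀ a ∈ N, a ^ p = 1 := by
    obtain ⟨p, hp, M, hMn, hMN, hMb, h⟩ := N.exists_normal_elementary_le hNn hNb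
    obtain rfl := (hmin M hMn hMN).resolve_left hMb
    exact ⟨p, hp, h⟩
  obtain ⟨p, hp, hcomm, hexp⟩ := hcomm_exp
  have : Fact p.Prime := ⟨hp⟩
  set q := ordProj[p] (Nat.card A) with hq
  set m := ordCompl[p] (Nat.card A) with hm
  have hmul : m * q = Nat.card A := by
    rw [mul_comm]
    exact Nat.ordProj_mul_ordCompl_eq_self _ _
  have hcop : m.Coprime q := ((Nat.coprime_ordCompl hp Nat.card_pos.ne').pow_left _).symm
  set J : Subgroup A := (powMonoidHom q : A →* A).ker with hJdef
  have hJcard : Nat.card J = q := card_ker_powMonoidHom_of_coprime hcop hmul.symm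
  have hJmem : ∀ b, b ∈ J ↔ b ^ q = 1 := fun b => Iff.rfl
  have hJ : ∀ g, ∀ b ∈ J, φ g b ∈ J := by
    intro g b hb
    rw [hJmem] at hb ⊢
    rw [← map_pow, hb, map_one]
  set P := cocyclePreimage φ β hβ J hJ with hPdef
  have hPcard : Nat.card P = p ^ (Nat.card G).factorization p := by
    rw [card_cocyclePreimage, hJcard, hq, Nat.card_congr β]
  have hPp : IsPGroup p P := IsPGroup.of_card hPcard
  have hNp : IsPGroup p N := fun v => ⟨1, Subtype.ext (by simpa using hexp v v.2)⟩
  have hNP : N ≤ P := hNp.le_sylow_of_normal (Sylow.ofCard P hPcard)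
  have hpN : p ∣ Nat.card N := by
    refine hNp.card_eq_or_dvd.resolve_left fun h => hNb ?_
    exact Subgroup.card_eq_one.mp h
  have hN_div : ∀ v ∈ N, ∀ b, φ v b / b ∈ J := fun v hv b =>
    div_mem_of_normal_le_cocyclePreimage hβ hJ hNn hNP hv b
  have hPn : P.Normal := by
    refine cocyclePreimage_normal hβ hJ fun g b => ?_
    have hb : b ∈ Subgroup.closure (Set.range a) := hgen ▸ Subgroup.mem_top b
    induction hb using Subgroup.closure_induction with
    | mem b hb =>
      obtain ⟨x, rfl⟩ := hb
      obtain ⟨v, hv, hvx⟩ := htrans x (g • x)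
      rw [ha, ← hvx, ← ha]
      exact hN_div v hv _
    | one => simp
    | mul b c _ _ hb hc =>
      rw [map_mul, mul_div_mul_comm]
      exact J.mul_mem hb hc
    | inv b _ hb =>
      rw [map_inv, inv_div_inv, ← inv_div]
      exact J.inv_mem hb
  have hNC : N ≤ Subgroup.centralizer (P : Set G) := by
    have hCb : N ⊓ Subgroup.centralizer (P : Set G) ≠ ⊥ := by
      obtain ⟨v, hv, hv1, hfix⟩ := hPp.exists_ne_one_fixed (MulAut.conj.comp P.subtype) N
        (fun g v hv => hNn.conj_mem v hv g) hpN
      intro h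
      refine hv1 (Subgroup.mem_bot.mp (h ▸ ⟨hv, ?_⟩))
      intro g hg
      exact mul_inv_eq_iff_eq_mul.mp (hfix ⟨g, hg⟩)
    exact inf_eq_left.mp ((hmin _ inferInstance inf_le_left).resolve_left hCb)
  have hPN : P ≤ N := by
    intro g hg
    obtain ⟨v, hv, hvx⟩ := htrans x (g • x)
    rwa [← eq_of_commute_of_smul_eq htrans (hcomm v hv) (fun w hw => hNC hw g hg) hvx]
  have hker : φ.ker ⊓ N ≠ ⊥ := by
    obtain ⟨b, hb, hb1, hfix⟩ := hNp.exists_ne_one_fixed (φ.comp N.subtype) J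
      (fun g => hJ g) (hJcard ▸ (hJcard ▸ card_cocyclePreimage hβ hJ) ▸
        hpN.trans (Subgroup.card_dvd_of_le hNP))
    have hv : β.symm b ∈ N := hPN (by rwa [mem_cocyclePreimage, Equiv.apply_symm_apply])
    have hv1 : β.symm b ≠ 1 := fun h => hb1 (by
      rw [← β.apply_symm_apply b, h, cocycle_one hβ])
    set v := β.symm b with hvdef
    have hvb : β v = b := β.apply_symm_apply b
    have hvJ : ∀ c ∈ J, φ v c = c := by
      intro c hc
      obtain ⟨w, rfl⟩ := β.surjective c
      have hw : w ∈ N := hPN hc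
      have h1 := hβ v w
      rw [hcomm v hv w hw, hβ w v, hvb, show φ w b = b from hfix ⟨w, hw⟩, mul_comm] at h1
      exact (mul_left_cancel h1).symm
    have hvA : ∀ c, φ v c = c := by
      intro c
      have h1 : (φ v c / c) ^ q = 1 := hN_div v hv c
      have h2 : (φ v c / c) ^ m = 1 := by
        rw [div_pow, ← map_pow, hvJ, div_self']
        rw [hJmem, ← pow_mul, hmul, pow_card_eq_one']
      rw [← div_eq_one, ← orderOf_eq_one_iff]
      exact Nat.eq_one_of_dvd_coprimes hcop (orderOf_dvd_of_pow_eq_one h2)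
        (orderOf_dvd_of_pow_eq_one h1)
    intro h
    refine hv1 (Subgroup.mem_bot.mp (h ▸ ⟨?_, hv⟩))
    exact MulEquiv.ext hvA
  have hNker : N ≤ φ.ker :=
    inf_eq_right.mp ((hmin _ inferInstance inf_le_right).resolve_left hker)
  obtain ⟨v, hv, rfl⟩ := htrans x y
  rw [← ha, MonoidHom.mem_ker.mp (hNker hv), MulAut.one_apply]

end Cocycle

section CycleSet

variable {X : Type*} {σ : X → Equiv.Perm X}

theorem Nondeg.injective_mul_inv_sigmaG (hnd : Nondeg σ) (y : X) :
    Function.Injective fun g : permGroup σ => g * (sigmaG σ ((g : Equiv.Perm X)⁻¹ y))⁻¹ := by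
  intro g h hgh
  have key : ∀ k : permGroup σ, ((k * (sigmaG σ ((k : Equiv.Perm X)⁻¹ y))⁻¹ : permGroup σ) :
      Equiv.Perm X)⁻¹ y = σ ((k : Equiv.Perm X)⁻¹ y) ((k : Equiv.Perm X)⁻¹ y) := by
    intro k
    simp [sigmaG]
  have h1 := key g
  have h2 := key h
  simp only at hgh
  rw [hgh, h2] at h1
  have h3 := hnd.1 h1
  rw [← h3] at hgh
  exact mul_right_cancel hgh

/-- The permutation `g ↦ g * (σ_{g⁻¹ y})⁻¹` of the permutation group. -/
noncomputable def Nondeg.translation [Finite X] (hnd : Nondeg σ) (y : X) :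
    Equiv.Perm (permGroup σ) :=
  Equiv.ofBijective _ (Finite.injective_iff_bijective.mp (hnd.injective_mul_inv_sigmaG y))

theorem Nondeg.translation_apply [Finite X] (hnd : Nondeg σ) (y : X) (g : permGroup σ) :
    hnd.translation y g = g * (sigmaG σ ((g : Equiv.Perm X)⁻¹ y))⁻¹ :=
  rfl

theorem Nondeg.translation_commute [Finite X] (hnd : Nondeg σ) (hlaw : CycleSetLaw σ) (x y : X) :
    hnd.translation x * hnd.translation y = hnd.translation y * hnd.translation x := by
  have key : ∀ x y, ∀ g : permGroup σ, hnd.translation x (hnd.translation y g) =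
      g * (sigmaG σ (σ ((g : Equiv.Perm X)⁻¹ y) ((g : Equiv.Perm X)⁻¹ x)) *
        sigmaG σ ((g : Equiv.Perm X)⁻¹ y))⁻¹ := by
    intro x y g
    rw [hnd.translation_apply, hnd.translation_apply, mul_inv_rev, mul_assoc]
    simp [sigmaG]
  ext1 g
  rw [Equiv.Perm.mul_apply, Equiv.Perm.mul_apply, key, key]
  congr 2
  ext z
  exact hlaw _ _ z

theorem Nondeg.conj_translation [Finite X] (hnd : Nondeg σ) (g : permGroup σ) (x : X) :
    MulAction.toPermHom (permGroup σ) (permGroup σ) g * hnd.translation x *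
      (MulAction.toPermHom (permGroup σ) (permGroup σ) g)⁻¹ =
      hnd.translation ((g : Equiv.Perm X) x) := by
  rw [mul_inv_eq_iff_eq_mul]
  ext1 h
  simp [hnd.translation_apply, mul_assoc]

/-- The abelian group generated by the translations. -/
noncomputable abbrev Nondeg.translationGroup [Finite X] (hnd : Nondeg σ) :
    Subgroup (Equiv.Perm (permGroup σ)) :=
  Subgroup.closure (Set.range hnd.translation)

theorem Nondeg.exists_translationGroup_apply_one [Finite X] (hnd : Nondeg σ) (g : permGroup σ) :
    ∃ u ∈ hnd.translationGroup, u 1 = g := by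
  have key : ∀ g (hg : g ∈ permGroup σ), ∀ h : permGroup σ,
      (∃ u ∈ hnd.translationGroup, u 1 = h) ↔
        ∃ u ∈ hnd.translationGroup, u 1 = h * ⟨g, hg⟩ := by
    intro g hg
    induction hg using Subgroup.closure_induction with
    | mem g hg =>
      obtain ⟨x, rfl⟩ := hg
      intro h
      set k : permGroup σ := h * ⟨σ x, Subgroup.subset_closure ⟨x, rfl⟩⟩ with hk
      have hT : hnd.translation ((k : Equiv.Perm X) x) k = h := by
        rw [hnd.translation_apply, Equiv.Perm.inv_def, Equiv.symm_apply_apply, hk]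
        exact mul_inv_cancel_right _ _
      have hU : hnd.translation ((k : Equiv.Perm X) x) ∈ hnd.translationGroup :=
        Subgroup.subset_closure ⟨_, rfl⟩
      constructor
      · rintro ⟨u, hu, hu1⟩
        refine ⟨_, mul_mem (inv_mem hU) hu, ?_⟩
        rw [Equiv.Perm.mul_apply, hu1, Equiv.Perm.inv_eq_iff_eq, hT]
      · rintro ⟨u, hu, hu1⟩
        refine ⟨_, mul_mem hU hu, ?_⟩
        rw [Equiv.Perm.mul_apply, hu1, hT]
    | one => exact fun h => by rw [show (⟨1, _⟩ : permGroup σ) = 1 from rfl, mul_one]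
    | mul a b ha hb iha ihb =>
      intro h
      rw [iha h, ihb, mul_assoc]
      rfl
    | inv a ha iha =>
      intro h
      rw [iha (h * _), mul_assoc]
      rw [show (⟨a⁻¹, inv_mem ha⟩ : permGroup σ) * ⟨a, ha⟩ = 1 from
        inv_mul_cancel (⟨a, ha⟩ : permGroup σ),
        mul_one]
  have := (key g g.2 1).mp ⟨1, one_mem _, rfl⟩
  rwa [one_mul] at this

theorem CycleSetLaw.exists_bijective_cocycle [Finite X] (hlaw : CycleSetLaw σ) (hnd : Nondeg σ) :
    ∃ (A : Subgroup (Equiv.Perm (permGroup σ))) (_ : IsMulCommutative A)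
      (φ : permGroup σ →* MulAut A) (β : permGroup σ ≃ A) (a : X → A),
      (∀ g h, β (g * h) = β g * φ g (β h)) ∧
      (∀ (g : permGroup σ) x, φ g (a x) = a ((g : Equiv.Perm X) x)) ∧
      Subgroup.closure (Set.range a) = ⊤ ∧ ∀ x, β (sigmaG σ x)⁻¹ = a x := by
  have hcomm : IsMulCommutative hnd.translationGroup := by
    refine Subgroup.isMulCommutative_closure ?_
    rintro _ ⟨x, rfl⟩ _ ⟨y, rfl⟩
    exact hnd.translation_commute hlaw x y
  have hmc : ∀ u ∈ hnd.translationGroup, ∀ w ∈ hnd.translationGroup, u * w = w * u :=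
    fun u hu w hw => congrArg Subtype.val (hcomm.is_comm.comm ⟨u, hu⟩ ⟨w, hw⟩)
  let L := MulAction.toPermHom (permGroup σ) (permGroup σ)
  have hLmem : ∀ g, ∀ u ∈ hnd.translationGroup, L g * u * (L g)⁻¹ ∈ hnd.translationGroup := by
    intro g u hu
    induction hu using Subgroup.closure_induction with
    | mem u hu =>
      obtain ⟨x, rfl⟩ := hu
      rw [hnd.conj_translation]
      exact Subgroup.subset_closure ⟨_, rfl⟩
    | one => simp
    | mul u w _ _ hu hw => simpa [mul_assoc] using mul_mem hu hw
    | inv u _ hu => simpa [mul_assoc] using inv_mem hu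
  have hLnorm : ∀ g, L g ∈ Subgroup.normalizer (hnd.translationGroup : Set _) := by
    intro g
    rw [Subgroup.mem_normalizer_iff]
    refine fun u => ⟨hLmem g u, fun hu => ?_⟩
    simpa [mul_assoc] using hLmem g⁻¹ _ hu
  let φ : permGroup σ →* MulAut hnd.translationGroup :=
    hnd.translationGroup.normalizerMonoidHom.comp (L.codRestrict _ hLnorm)
  have hφ : ∀ g u, ((φ g u : hnd.translationGroup) : Equiv.Perm (permGroup σ)) =
      L g * u * (L g)⁻¹ := fun g u => rfl
  let ev : hnd.translationGroup → permGroup σ := fun u => (u : Equiv.Perm (permGroup σ)) 1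
  have hev : Function.Bijective ev := by
    refine ⟨fun u w huw => Subtype.ext (Equiv.ext fun g => ?_), fun g => ?_⟩
    · obtain ⟨t, ht, rfl⟩ := hnd.exists_translationGroup_apply_one g
      rw [← Equiv.Perm.mul_apply, ← Equiv.Perm.mul_apply, hmc _ u.2 _ ht, hmc _ w.2 _ ht,
        Equiv.Perm.mul_apply, Equiv.Perm.mul_apply]
      exact congrArg t huw
    · obtain ⟨t, ht, h⟩ := hnd.exists_translationGroup_apply_one g
      exact ⟨⟨t, ht⟩, h⟩
  let E := Equiv.ofBijective ev hev
  refine ⟨hnd.translationGroup, hcomm, φ, E.symm, fun x => ⟨hnd.translation x,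
    Subgroup.subset_closure ⟨x, rfl⟩⟩, fun g h => ?_, fun g x => ?_, ?_, fun x => ?_⟩
  · rw [Equiv.symm_apply_eq]
    have hE : ∀ k, (E.symm k : Equiv.Perm (permGroup σ)) 1 = k := fun k => E.apply_symm_apply k
    change g * h =
      ((E.symm g : Equiv.Perm (permGroup σ)) * (φ g (E.symm h) : hnd.translationGroup)) 1
    have hLg : (L g)⁻¹ g = 1 := by
      rw [Equiv.Perm.inv_eq_iff_eq]
      exact (mul_one g).symm
    rw [hmc _ (E.symm g).2 _ (φ g _).2, Equiv.Perm.mul_apply, hE, hφ, Equiv.Perm.mul_apply,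
      Equiv.Perm.mul_apply, hLg, hE]
    rfl
  · exact Subtype.ext (hnd.conj_translation g x)
  · rw [← Subgroup.closure_closure_coe_preimage]
    congr 1
    ext u
    constructor
    · rintro ⟨x, rfl⟩
      exact ⟨x, rfl⟩
    · rintro ⟨x, hx⟩
      exact ⟨x, Subtype.ext hx⟩
  · rw [Equiv.symm_apply_eq]
    exact (one_mul _).symm

end CycleSet

/-- a finite indecomposable non-degenerate cycle set whose permutation
group has a minimal normal subgroup acting transitively (innately transitive) has
prime cardinality `p` and is the trivial indecomposable cycle set of size `p`. -/
theorem stmt_3 {X : Type*} [Finite X] (σ : X → Equiv.Perm X)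
    (hlaw : CycleSetLaw σ) (hnd : Nondeg σ) (hind : Indecomposable σ)
    (N : Subgroup ↥(permGroup σ)) (hNnorm : N.Normal) (hNbot : N ≠ ⊥)
    (hNmin : ∀ M : Subgroup ↥(permGroup σ), M.Normal → M ≤ N → M = ⊥ ∨ M = N)
    (hNtrans : ∀ x y : X, ∃ g ∈ N, (g : Equiv.Perm X) x = y) :
    (Nat.card X).Prime ∧
    ∃ γ : Equiv.Perm X, γ.IsCycle ∧ (∀ x : X, γ x ≠ x) ∧ ∀ x : X, σ x = γ := by
  have hconst : ∀ x y, σ x = σ y := by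
    obtain ⟨A, hA, φ, β, a, hβ, ha, hgen, hσ⟩ := hlaw.exists_bijective_cocycle hnd
    intro x y
    let _ : CommGroup A := { A.toGroup with mul_comm := hA.is_comm.comm }
    have h : a x = a y := cocycle_const_of_innatelyTransitive (A := A) hβ ha hgen hNnorm hNbot
      hNmin hNtrans x y
    rw [← hσ, ← hσ] at h
    exact congrArg Subtype.val (inv_injective (β.injective h))
  obtain ⟨⟨v, hv⟩, hv1⟩ := (Subgroup.ne_bot_iff_exists_ne_one).mp hNbot
  have hne : Nonempty X := by
    by_contra hX
    rw [not_nonempty_iff] at hX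
    exact hv1 (Subtype.ext (Subtype.ext (Subsingleton.elim _ _)))
  obtain ⟨x₀⟩ := hne
  have hpow : ∀ g ∈ permGroup σ, ∃ k : ℤ, σ x₀ ^ k = g := by
    intro g hg
    have hle : permGroup σ ≤ Subgroup.zpowers (σ x₀) := by
      refine (Subgroup.closure_le _).mpr ?_
      rintro _ ⟨x, rfl⟩
      rw [hconst x x₀]
      exact Subgroup.mem_zpowers _
    exact Subgroup.mem_zpowers_iff.mp (hle hg)
  have hcomm : ∀ g h : permGroup σ, g * h = h * g := by
    rintro ⟨g, hg⟩ ⟨h, hh⟩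
    obtain ⟨k, rfl⟩ := hpow g hg
    obtain ⟨l, rfl⟩ := hpow h hh
    exact Subtype.ext (Commute.zpow_zpow_self (σ x₀) k l)
  have hprime : (Nat.card N).Prime := by
    have : Nontrivial N := (Subgroup.nontrivial_iff_ne_bot N).mpr hNbot
    obtain ⟨r, hr, hrd⟩ := Nat.exists_prime_and_dvd (Finite.one_lt_card (α := N)).ne'
    have : Fact r.Prime := ⟨hr⟩
    obtain ⟨w, hw⟩ := exists_prime_orderOf_dvd_card' r hrd
    have hw' : orderOf (w : permGroup σ) = r := by rw [Subgroup.orderOf_coe, hw]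
    have hnormal : (Subgroup.zpowers (w : permGroup σ)).Normal := ⟨fun k hk g => by
      rwa [hcomm g k, mul_inv_cancel_right]⟩
    have hle : Subgroup.zpowers (w : permGroup σ) ≤ N := by
      rw [Subgroup.zpowers_le]
      exact w.2
    rcases hNmin _ hnormal hle with h | h
    · rw [Subgroup.zpowers_eq_bot] at h
      rw [h, orderOf_one] at hw'
      exact absurd hw' hr.one_lt.ne
    · rwa [← h, Nat.card_zpowers, hw']
  have hcard : Nat.card N = Nat.card X := by
    refine Nat.card_eq_of_bijective (fun g : N => (g : permGroup σ) • x₀) ⟨fun g h hgh => ?_,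
      fun y => ?_⟩
    · exact Subtype.ext (eq_of_commute_of_smul_eq hNtrans (fun _ _ => hcomm _ _)
        (fun _ _ => hcomm _ _) hgh)
    · obtain ⟨g, hg, hgy⟩ := hNtrans x₀ y
      exact ⟨⟨g, hg⟩, hgy⟩
  have hX : (Nat.card X).Prime := hcard ▸ hprime
  have hcycle : ∀ x y, (σ x₀).SameCycle x y := by
    intro x y
    obtain ⟨g, hg, rfl⟩ := hind x y
    obtain ⟨k, rfl⟩ := hpow g hg
    exact ⟨k, rfl⟩
  have hfix : ∀ x, σ x₀ x ≠ x := by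
    intro x hx
    have : Subsingleton X := ⟨fun y z => by
      obtain ⟨k, rfl⟩ := hcycle x y
      obtain ⟨l, rfl⟩ := hcycle x z
      rw [Function.IsFixedPt.perm_zpow hx, Function.IsFixedPt.perm_zpow hx]⟩
    exact hX.one_lt.not_ge (Finite.card_le_one_iff_subsingleton.mpr this)
  exact ⟨hX, σ x₀, ⟨x₀, hfix x₀, fun y _ => hcycle x₀ y⟩, hfix, fun x => hconst x x₀⟩
end

section
/- Let X be a finite indecomposable non-degenerate cycle set of prime cardinality p. Then there is a p-cycle γ ∈ Sym(X) such that x·y = γ(y) for all x,y ∈ X; moreover, any two cycle sets of this form on a set of size p are isomorphic, so X is unique up to isomorphism. -/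
section Auxiliary

open MulAction
open scoped Pointwise

/-- A function on a transitive set of prime size whose fibres are permuted by the group is
injective or constant. -/
theorem MulAction.injective_or_constant_of_prime_card {X G : Type*} [Group G]
    [MulAction G X] [IsPretransitive G X] {B : Type*} (hX : (Nat.card X).Prime) (f : X → B)
    (hf : ∀ (g : G) (x y : X), f x = f y → f (g • x) = f (g • y)) :
    Function.Injective f ∨ ∀ x y, f x = f y := by
  have := IsPreprimitive.of_prime_card (G := G) hX
  by_contra! hcon
  obtain ⟨hinj, x, y, hxy⟩ := hcon
  refine hinj fun z w hzw => ?_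
  have hblock : IsBlock G {v | f v = f z} := by
    rw [isBlock_iff_smul_eq_of_mem]
    intro g v hv hgv
    simp only [Set.mem_ofPred_eq] at hv hgv
    ext u
    rw [Set.mem_smul_set_iff_inv_smul_mem, Set.mem_ofPred_eq, Set.mem_ofPred_eq, ← hv]
    constructor
    · intro hu
      have := hf g _ _ hu
      rw [smul_inv_smul] at this
      rw [this, hgv, hv]
    · intro hu
      have := hf g⁻¹ u (g • v) (by rw [hu, hgv, hv])
      rwa [inv_smul_smul] at this
  rcases hblock.subsingleton_or_eq_univ with hs | hu
  · exact hs rfl hzw.symm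
  · have hall : ∀ v, f v = f z := fun v => by
      have : v ∈ {v | f v = f z} := hu ▸ Set.mem_univ v
      exact this
    exact absurd ((hall x).trans (hall y).symm) hxy

/-- In a finite abelian group of order `p * N` with `p` prime not dividing `N`, there are at most
`p` multiples of `N`. -/
theorem AddCommGroup.card_nsmul_range_le {A : Type*} [AddCommGroup A] [Finite A] {p N : ℕ}
    (hp : p.Prime)
    (hA : Nat.card A = p * N) (hpN : ¬ p ∣ N) :
    Nat.card (nsmulAddMonoidHom (α := A) N).range ≤ p := by
  set R := (nsmulAddMonoidHom (α := A) N).range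
  have hcop : (Nat.card R).Coprime N := by
    refine Nat.Coprime.symm (Nat.coprime_of_dvd fun q hq hqN hqR => ?_)
    have := Fact.mk hq
    obtain ⟨⟨_, a, rfl⟩, ha⟩ := exists_prime_addOrderOf_dvd_card' q hqR
    have hpa : p • (⟨nsmulAddMonoidHom N a, a, rfl⟩ : R) = 0 := by
      apply Subtype.ext
      simp [← mul_nsmul', ← hA]
    have hqp : q ∣ p := ha ▸ addOrderOf_dvd_of_nsmul_eq_zero hpa
    rw [(Nat.prime_dvd_prime_iff_eq hq hp).1 hqp] at hqN
    exact hpN hqN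
  have hdvd : Nat.card R ∣ p * N := hA ▸ R.card_addSubgroup_dvd_card
  exact Nat.le_of_dvd hp.pos (hcop.dvd_of_dvd_mul_right hdvd)

end Auxiliary

namespace CycleSetLaw

open MulAction

section Multisets

variable {X : Type*} {σ : X → Equiv.Perm X}

/-- The operation `g ↦ σ_{g(x)} ∘ g` commutes with itself for different `x`. -/
theorem leftCommutative (h : CycleSetLaw σ) :
    LeftCommutative fun (x : X) (g : Equiv.Perm X) => σ (g x) * g :=
  ⟨fun x y g => Equiv.ext fun z => by
    simpa using h (g y) (g x) (g z)⟩

/-- The extension of `σ` to multisets, determined by `σ_0 = 1` and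
`σ_{a + x} = σ_{σ_a(x)} ∘ σ_a`. -/
def multisetPerm (h : CycleSetLaw σ) (a : Multiset X) : Equiv.Perm X :=
  haveI := h.leftCommutative
  a.foldr (fun (x : X) (g : Equiv.Perm X) => σ (g x) * g) 1

variable (h : CycleSetLaw σ)

@[simp]
theorem multisetPerm_zero : h.multisetPerm 0 = 1 := rfl

theorem multisetPerm_cons (x : X) (a : Multiset X) :
    h.multisetPerm (x ::ₘ a) = σ (h.multisetPerm a x) * h.multisetPerm a :=
  haveI := h.leftCommutative
  Multiset.foldr_cons (fun (x : X) (g : Equiv.Perm X) => σ (g x) * g) 1 x a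

@[simp]
theorem multisetPerm_singleton (x : X) : h.multisetPerm {x} = σ x := by
  simpa using h.multisetPerm_cons x 0

theorem multisetPerm_add (a b : Multiset X) :
    h.multisetPerm (a + b) = h.multisetPerm (b.map (h.multisetPerm a)) * h.multisetPerm a := by
  induction b using Multiset.induction with
  | empty => simp
  | cons x b ih =>
    rw [Multiset.add_cons, multisetPerm_cons, ih, Multiset.map_cons, multisetPerm_cons]
    simp [mul_assoc]

theorem multisetPerm_mul (a b : Multiset X) :
    h.multisetPerm b * h.multisetPerm a =
      h.multisetPerm (a + b.map ⇑(h.multisetPerm a)⁻¹) := by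
  rw [multisetPerm_add, Multiset.map_map]
  simp

theorem multisetPerm_mem (a : Multiset X) : h.multisetPerm a ∈ permGroup σ := by
  induction a using Multiset.induction with
  | empty => exact one_mem _
  | cons x a ih =>
    rw [multisetPerm_cons]
    exact mul_mem (Subgroup.subset_closure ⟨_, rfl⟩) ih

theorem exists_multisetPerm_eq [Finite X] {g : Equiv.Perm X} (hg : g ∈ permGroup σ) :
    ∃ a, h.multisetPerm a = g := by
  have hg' : g ∈ Submonoid.closure (Set.range σ) := by
    rw [← Subgroup.closure_toSubmonoid_of_finite]
    exact hg
  induction hg' using Submonoid.closure_induction with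
  | mem g hx =>
    obtain ⟨x, rfl⟩ := hx
    exact ⟨{x}, h.multisetPerm_singleton x⟩
  | one => exact ⟨0, rfl⟩
  | mul g k hg' hk' ihg ihk =>
    rw [← Subgroup.closure_toSubmonoid_of_finite] at hg' hk'
    obtain ⟨b, rfl⟩ := ihg hg'
    obtain ⟨a, rfl⟩ := ihk hk'
    exact ⟨_, (h.multisetPerm_mul a b).symm⟩

theorem multisetPerm_map_congr [Finite X] {g : Equiv.Perm X} (hg : g ∈ permGroup σ)
    {a b : Multiset X} (hab : h.multisetPerm a = h.multisetPerm b) :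
    h.multisetPerm (a.map g) = h.multisetPerm (b.map g) := by
  obtain ⟨c, rfl⟩ := h.exists_multisetPerm_eq hg
  apply mul_right_cancel (b := h.multisetPerm c)
  rw [← multisetPerm_add, ← multisetPerm_add, add_comm c, add_comm c, multisetPerm_add, hab,
    ← multisetPerm_add]

/-- Multisets acting by the same permutation are congruent. -/
def multisetCon : AddCon (Multiset X) where
  r a b := h.multisetPerm a = h.multisetPerm b
  iseqv := ⟨fun _ => rfl, Eq.symm, Eq.trans⟩
  add' := by
    intro a b c d hab hcd
    have key : ∀ a b c : Multiset X, h.multisetPerm a = h.multisetPerm b →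
        h.multisetPerm (a + c) = h.multisetPerm (b + c) := fun a b c hab => by
      rw [multisetPerm_add, hab, ← multisetPerm_add]
    exact (key a b c hab).trans (by rw [add_comm b, add_comm b]; exact key c d b hcd)

/-- The additive group of the permutation brace, as a quotient of the free commutative monoid. -/
abbrev BraceAdd : Type _ := h.multisetCon.Quotient

/-- The class of a multiset in the additive group of the permutation brace. -/
abbrev toBraceAdd : Multiset X →+ h.BraceAdd := h.multisetCon.mk'

theorem toBraceAdd_eq_iff {a b : Multiset X} :
    h.toBraceAdd a = h.toBraceAdd b ↔ h.multisetPerm a = h.multisetPerm b :=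
  h.multisetCon.eq

theorem toBraceAdd_surjective : Function.Surjective h.toBraceAdd :=
  AddCon.mk'_surjective

variable [Finite X]

/-- The additive and the multiplicative group of the permutation brace have the same elements. -/
noncomputable def braceAddEquiv : h.BraceAdd ≃ permGroup σ :=
  Equiv.ofBijective
    (fun u => Quotient.liftOn u (fun a => (⟨h.multisetPerm a, h.multisetPerm_mem a⟩ : permGroup σ))
      fun _ _ hab => Subtype.ext hab)
    ⟨fun u v => by
      obtain ⟨a, rfl⟩ := h.toBraceAdd_surjective u
      obtain ⟨b, rfl⟩ := h.toBraceAdd_surjective v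
      exact fun hab => h.toBraceAdd_eq_iff.2 (congrArg Subtype.val hab),
    fun g => by
      obtain ⟨a, ha⟩ := h.exists_multisetPerm_eq g.2
      exact ⟨h.toBraceAdd a, Subtype.ext ha⟩⟩

instance : Finite h.BraceAdd := Finite.of_equiv _ h.braceAddEquiv.symm

theorem braceAdd_add_left_cancel (u v w : h.BraceAdd) (huv : u + v = u + w) : v = w := by
  obtain ⟨a, rfl⟩ := h.toBraceAdd_surjective u
  obtain ⟨b, rfl⟩ := h.toBraceAdd_surjective v
  obtain ⟨c, rfl⟩ := h.toBraceAdd_surjective w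
  rw [← map_add, ← map_add, toBraceAdd_eq_iff, multisetPerm_add, multisetPerm_add] at huv
  have key := h.multisetPerm_map_congr (inv_mem (h.multisetPerm_mem a)) (mul_right_cancel huv)
  rw [toBraceAdd_eq_iff]
  simpa [Multiset.map_map, ← Equiv.Perm.coe_mul] using key

noncomputable instance : AddCommGroup h.BraceAdd :=
  letI : AddLeftCancelMonoid h.BraceAdd :=
    { (inferInstance : AddCommMonoid h.BraceAdd) with
      add_left_cancel := h.braceAdd_add_left_cancel }
  { AddLeftCancelMonoid.addGroupOfFinite, (inferInstance : AddCommMonoid h.BraceAdd) with }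

end Multisets

section Prime

variable {X : Type*} {σ : X → Equiv.Perm X} [Finite X] (h : CycleSetLaw σ)

/-- If a multiple of the generators does not depend on the generator, it defines a homomorphism on
the permutation group. -/
noncomputable def nsmulHom (N : ℕ)
    (hN : ∀ x y : X, N • h.toBraceAdd {x} = N • h.toBraceAdd {y}) :
    permGroup σ →* Multiplicative h.BraceAdd :=
  MonoidHom.mk' (fun g => Multiplicative.ofAdd (N • h.braceAddEquiv.symm g)) (by
    have hmap : ∀ (g : Equiv.Perm X) (b : Multiset X),
        N • h.toBraceAdd (b.map g) = N • h.toBraceAdd b := by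
      intro g b
      induction b using Multiset.induction with
      | empty => simp
      | cons x b ih =>
        rw [Multiset.map_cons, ← Multiset.singleton_add, ← Multiset.singleton_add, map_add,
          map_add, nsmul_add, nsmul_add, ih, hN (g x) x]
    intro g k
    obtain ⟨u, rfl⟩ := h.braceAddEquiv.surjective g
    obtain ⟨v, rfl⟩ := h.braceAddEquiv.surjective k
    obtain ⟨b, rfl⟩ := h.toBraceAdd_surjective u
    obtain ⟨a, rfl⟩ := h.toBraceAdd_surjective v
    have hmul : h.braceAddEquiv (h.toBraceAdd b) * h.braceAddEquiv (h.toBraceAdd a) =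
        h.braceAddEquiv (h.toBraceAdd (a + b.map ⇑(h.multisetPerm a)⁻¹)) :=
      Subtype.ext (h.multisetPerm_mul a b)
    rw [hmul]
    simp only [Equiv.symm_apply_apply]
    rw [map_add, nsmul_add, hmap, add_comm, ofAdd_add])

theorem nsmulHom_sigmaG (N : ℕ)
    (hN : ∀ x y : X, N • h.toBraceAdd {x} = N • h.toBraceAdd {y}) (x : X) :
    h.nsmulHom N hN (sigmaG σ x) = Multiplicative.ofAdd (N • h.toBraceAdd {x}) := by
  have hx : sigmaG σ x = h.braceAddEquiv (h.toBraceAdd {x}) :=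
    Subtype.ext (h.multisetPerm_singleton x).symm
  simp [nsmulHom, hx]

theorem mem_ker_nsmulHom (N : ℕ)
    (hN : ∀ x y : X, N • h.toBraceAdd {x} = N • h.toBraceAdd {y}) (g : permGroup σ) :
    g ∈ (h.nsmulHom N hN).ker ↔ N • h.braceAddEquiv.symm g = 0 :=
  Iff.rfl

/-- All left translations of an indecomposable cycle set of prime size coincide. -/
theorem sigma_constant (h : CycleSetLaw σ) {p : ℕ} (hp : p.Prime) (hcard : Nat.card X = p)
    (hind : Indecomposable σ) (x y : X) : σ x = σ y := by
  have htrans : IsPretransitive (permGroup σ) X := ⟨fun x y => by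
    obtain ⟨g, hg, hxy⟩ := hind x y
    exact ⟨⟨g, hg⟩, hxy⟩⟩
  have hX : (Nat.card X).Prime := hcard ▸ hp
  have hprim := IsPreprimitive.of_prime_card (G := permGroup σ) hX
  have : Nontrivial X := Finite.one_lt_card_iff_nontrivial.1 (hcard ▸ hp.one_lt)
  have hpG : p ∣ Nat.card (permGroup σ) := by
    rw [← hcard, ← MulAction.index_stabilizer_of_transitive (permGroup σ) x]
    exact Subgroup.index_dvd_card _
  obtain ⟨N, hN⟩ := hpG
  have hpN : ¬ p ∣ N := by
    have hdvd : Nat.card (permGroup σ) ∣ Nat.card (Equiv.Perm X) :=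
      Subgroup.card_subgroup_dvd_card _
    rw [Nat.card_perm, hcard, hN, ← Nat.mul_factorial_pred hp.ne_zero] at hdvd
    intro hpN
    have := (hp.dvd_factorial).1 (hpN.trans (Nat.dvd_of_mul_dvd_mul_left hp.pos hdvd))
    have := hp.pos
    omega
  have hA : Nat.card h.BraceAdd = p * N := (Nat.card_congr h.braceAddEquiv).trans hN
  have hconst : ∀ x y : X, N • h.toBraceAdd {x} = N • h.toBraceAdd {y} := by
    have hf : ∀ (g : permGroup σ) (x y : X), N • h.toBraceAdd {x} = N • h.toBraceAdd {y} →
        N • h.toBraceAdd {g • x} = N • h.toBraceAdd {g • y} := by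
      intro g x y hxy
      rw [← map_nsmul, ← map_nsmul, toBraceAdd_eq_iff] at hxy ⊢
      simpa [Multiset.map_nsmul, Subgroup.smul_def] using h.multisetPerm_map_congr g.2 hxy
    rcases injective_or_constant_of_prime_card hX (fun x => N • h.toBraceAdd {x}) hf with hinj | hc
    · by_cases hzero : ∃ x : X, N • h.toBraceAdd {x} = 0
      · obtain ⟨x, hx⟩ := hzero
        have hall : ∀ y : X, N • h.toBraceAdd {y} = 0 := by
          intro y
          obtain ⟨g, rfl⟩ := exists_smul_eq (permGroup σ) x y
          rw [← map_nsmul, ← map_zero h.toBraceAdd, toBraceAdd_eq_iff] at hx ⊢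
          simpa [Multiset.map_nsmul, Subgroup.smul_def] using h.multisetPerm_map_congr g.2 hx
        exact fun y z => (hall y).trans (hall z).symm
      · exfalso
        push Not at hzero
        let F : Option X → (nsmulAddMonoidHom (α := h.BraceAdd) N).range := fun o =>
          o.elim 0 fun x => ⟨N • h.toBraceAdd {x}, _, rfl⟩
        have hF : Function.Injective F := by
          rintro (_ | x) (_ | y) hxy
          · rfl
          · exact absurd (congrArg Subtype.val hxy).symm (hzero y)
          · exact absurd (congrArg Subtype.val hxy) (hzero x)
          · exact congrArg some (hinj (congrArg Subtype.val hxy))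
        have hle := Nat.card_le_card_of_injective F hF
        rw [Finite.card_option, hcard] at hle
        have := AddCommGroup.card_nsmul_range_le hp hA hpN
        omega
    · exact hc
  set K := (h.nsmulHom N hconst).ker with hK
  have hKcard : ¬ p ∣ Nat.card K := by
    intro hdvd
    let M := (nsmulAddMonoidHom (α := h.BraceAdd) N).ker
    have e : K ≃ M := h.braceAddEquiv.symm.subtypeEquiv fun g => h.mem_ker_nsmulHom N hconst g
    rw [Nat.card_congr e] at hdvd
    have := Fact.mk hp
    obtain ⟨⟨u, hu⟩, hord⟩ := exists_prime_addOrderOf_dvd_card' p hdvd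
    have hzero : N • (⟨u, hu⟩ : M) = 0 := Subtype.ext hu
    exact hpN (hord ▸ addOrderOf_dvd_of_nsmul_eq_zero hzero)
  have hfix : fixedPoints K X = Set.univ := by
    by_contra hne
    have := IsQuasiPreprimitive.isPretransitive_of_normal (G := permGroup σ) hne
    apply hKcard
    rw [← hcard, ← MulAction.index_stabilizer_of_transitive K x]
    exact Subgroup.index_dvd_card _
  have hker : (sigmaG σ x)⁻¹ * sigmaG σ y ∈ K := by
    rw [hK, MonoidHom.mem_ker, map_mul, map_inv, nsmulHom_sigmaG, nsmulHom_sigmaG, hconst x y,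
      inv_mul_cancel]
  refine Equiv.ext fun z => ?_
  have hz : z ∈ fixedPoints K X := hfix ▸ Set.mem_univ z
  have hz' : (σ x)⁻¹ (σ y z) = z := hz ⟨_, hker⟩
  exact (Equiv.Perm.inv_eq_iff_eq.1 hz').symm

end Prime

end CycleSetLaw

/-- Fixed-point-free cycles on finite sets of the same size are conjugate. -/
theorem Equiv.Perm.IsCycle.exists_conj_equiv {Y Z : Type*} [Finite Y] [Finite Z]
    (hcard : Nat.card Y = Nat.card Z) {γY : Equiv.Perm Y} {γZ : Equiv.Perm Z}
    (hY : γY.IsCycle) (hY' : ∀ y, γY y ≠ y) (hZ : γZ.IsCycle) (hZ' : ∀ z, γZ z ≠ z) :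
    ∃ f : Y ≃ Z, ∀ b, f (γY b) = γZ (f b) := by
  classical
  have := Fintype.ofFinite Z
  obtain ⟨e⟩ := Finite.card_eq.1 hcard
  have hfree : ∀ z, e.permCongr γY z ≠ z := fun z hz =>
    hY' (e.symm z) (by simpa [Equiv.permCongr_apply, ← Equiv.eq_symm_apply] using hz)
  have hcycle : (e.permCongr γY).IsCycle := by
    obtain ⟨y, -, hy⟩ := hY
    refine ⟨e y, hfree _, fun z _ => ?_⟩
    obtain ⟨n, hn⟩ := hy (hY' (e.symm z))
    refine ⟨n, ?_⟩
    have hpow : e.permCongr γY ^ n = e.permCongr (γY ^ n) := (map_zpow e.permCongrHom γY n).symm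
    simp [hpow, Equiv.permCongr_apply, hn]
  have hconj : IsConj (e.permCongr γY) γZ := by
    refine hcycle.isConj hZ (congrArg Finset.card ?_)
    ext z
    exact iff_of_true (Equiv.Perm.mem_support.2 (hfree z)) (Equiv.Perm.mem_support.2 (hZ' z))
  obtain ⟨c, hc⟩ := _root_.isConj_iff.1 hconj
  refine ⟨e.trans c, fun b => ?_⟩
  simp [← hc, Equiv.permCongr_apply]

/-- a finite indecomposable non-degenerate cycle set of prime cardinality
`p` is of the form `x·y = γ(y)` for a `p`-cycle `γ`; moreover any two cycle sets of
this form on a set of size `p` are isomorphic, so `X` is unique up to isomorphism. -/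
theorem stmt_4 {X : Type*} [Finite X] (p : ℕ) (hp : p.Prime) (σ : X → Equiv.Perm X)
    (hlaw : CycleSetLaw σ) (hnd : Nondeg σ) (hind : Indecomposable σ)
    (hcard : Nat.card X = p) :
    (∃ γ : Equiv.Perm X, γ.IsCycle ∧ (∀ x : X, γ x ≠ x) ∧ ∀ x : X, σ x = γ) ∧
    (∀ (Y Z : Type*) (γY : Equiv.Perm Y) (γZ : Equiv.Perm Z),
      Finite Y → Finite Z → Nat.card Y = p → Nat.card Z = p →
      γY.IsCycle → (∀ y : Y, γY y ≠ y) → γZ.IsCycle → (∀ z : Z, γZ z ≠ z) →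
      ∃ f : Y ≃ Z, ∀ a b : Y, f (γY b) = γZ (f b)) := by
  constructor
  · have : Nontrivial X := Finite.one_lt_card_iff_nontrivial.1 (hcard ▸ hp.one_lt)
    obtain ⟨x₀⟩ : Nonempty X := inferInstance
    have hconst : ∀ x, σ x = σ x₀ := fun x => hlaw.sigma_constant hp hcard hind x x₀
    have hsame : ∀ x y, (σ x₀).SameCycle x y := by
      intro x y
      obtain ⟨g, hg, hxy⟩ := hind x y
      have hrange : Set.range σ = {σ x₀} := by
        ext τ
        simp [hconst, eq_comm]
      rw [permGroup, hrange, ← Subgroup.zpowers_eq_closure] at hg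
      obtain ⟨n, rfl⟩ := hg
      exact ⟨n, hxy⟩
    have hfree : ∀ x, σ x₀ x ≠ x := by
      intro x hx
      obtain ⟨y, hy⟩ := exists_ne x
      exact hy ((hsame x y).eq_of_left hx).symm
    exact ⟨σ x₀, ⟨x₀, hfree x₀, fun y _ => hsame x₀ y⟩, hfree, hconst⟩
  · intro Y Z γY γZ _ _ hY hZ cY fY cZ fZ
    obtain ⟨f, hf⟩ := cY.exists_conj_equiv (hY.trans hZ.symm) fY cZ fZ
    exact ⟨f, fun _ b => hf b⟩
end

section
/- Let X be a finite latin left quasigroup that is right linear over a group (G,∘), i.e. X = G and x·y = φ(x) ∘ ψ(y) for a bijection φ of G and an automorphism ψ of (G,∘). Then the assignment H ↦ {x∘H : x ∈ G} is a bijection from the set of subgroups H of G with ψ(H) = H onto the set of complete block systems for the action of G(X) on X. -/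
/-- The left translations of the right linear left quasigroup `x·y = φ(x) ∘ ψ(y)`
over a group `(G,∘)`. -/
def rlSigma {G : Type*} [Group G] (φ : G ≃ G) (ψ : G ≃* G) (x : G) : Equiv.Perm G :=
  ψ.toEquiv.trans (Equiv.mulLeft (φ x))

/-- A block of imprimitivity for the action of `G(X)`. -/
def IsBlockLQ {X : Type*} (σ : X → Equiv.Perm X) (Y : Set X) : Prop :=
  ∀ g ∈ permGroup σ, (⇑g '' Y) ∩ Y = ∅ ∨ ⇑g '' Y = Y

/-- A complete block system: the partition `{g(Y) : g ∈ G(X)}` obtained from a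
(nonempty) block of imprimitivity `Y`. -/
def IsCompleteBlockSystem {X : Type*} (σ : X → Equiv.Perm X) (P : Set (Set X)) : Prop :=
  ∃ Y : Set X, Y.Nonempty ∧ IsBlockLQ σ Y ∧ P = {Z : Set X | ∃ g ∈ permGroup σ, Z = ⇑g '' Y}

theorem mulEquiv_mem_permGroup {G : Type*} [Group G] (φ : G ≃ G) (ψ : G ≃* G) :
    ψ.toEquiv ∈ permGroup (rlSigma φ ψ) := by
  have h : rlSigma φ ψ (φ.symm 1) = ψ.toEquiv := by ext; simp [rlSigma]
  exact h ▸ Subgroup.subset_closure ⟨_, rfl⟩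

theorem mulLeft_mem_permGroup {G : Type*} [Group G] (φ : G ≃ G) (ψ : G ≃* G) (a : G) :
    Equiv.mulLeft a ∈ permGroup (rlSigma φ ψ) := by
  have h : rlSigma φ ψ (φ.symm a) * (ψ.toEquiv : Equiv.Perm G)⁻¹ = Equiv.mulLeft a := by
    ext
    simp [rlSigma, Equiv.Perm.inv_def]
  exact h ▸ mul_mem (Subgroup.subset_closure ⟨_, rfl⟩) (inv_mem (mulEquiv_mem_permGroup φ ψ))

/-- Elements of `G(X)` preserve the left coset relation of a `ψ`-invariant subgroup. -/
theorem inv_mul_mem_iff_of_mem_permGroup {G : Type*} [Group G] {φ : G ≃ G} {ψ : G ≃* G}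
    {H : Subgroup G} (hH : ∀ g : G, g ∈ H ↔ ψ g ∈ H) {g : Equiv.Perm G}
    (hg : g ∈ permGroup (rlSigma φ ψ)) :
    ∀ x y : G, (g x)⁻¹ * g y ∈ H ↔ x⁻¹ * y ∈ H := by
  induction hg using Subgroup.closure_induction with
  | mem g hg =>
    obtain ⟨a, rfl⟩ := hg
    intro x y
    rw [hH (x⁻¹ * y)]
    simp [rlSigma, mul_assoc]
  | one => simp
  | mul g k _ _ ihg ihk =>
    intro x y
    rw [Equiv.Perm.mul_apply, Equiv.Perm.mul_apply, ihg, ihk]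
  | inv g _ ih =>
    intro x y
    simpa using (ih (g⁻¹ x) (g⁻¹ y)).symm

theorem image_leftCoset_of_mem_permGroup {G : Type*} [Group G] {φ : G ≃ G} {ψ : G ≃* G}
    {H : Subgroup G} (hH : ∀ g : G, g ∈ H ↔ ψ g ∈ H) {g : Equiv.Perm G}
    (hg : g ∈ permGroup (rlSigma φ ψ)) (x : G) :
    ⇑g '' ((fun h => x * h) '' (H : Set G)) = (fun h => g x * h) '' (H : Set G) := by
  ext z
  obtain ⟨w, rfl⟩ := g.surjective z
  rw [g.injective.mem_set_image, Set.image_mul_left, Set.image_mul_left]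
  exact (inv_mul_mem_iff_of_mem_permGroup hH hg x w).symm

theorem IsBlockLQ.apply_mem_iff {X : Type*} {σ : X → Equiv.Perm X} {Y : Set X}
    (hY : IsBlockLQ σ Y) {g : Equiv.Perm X} (hg : g ∈ permGroup σ) {z : X} (hz : z ∈ Y)
    (hgz : g z ∈ Y) (w : X) : g w ∈ Y ↔ w ∈ Y := by
  rcases hY g hg with h | h
  · exact absurd (h ▸ ⟨Set.mem_image_of_mem g hz, hgz⟩ : g z ∈ (∅ : Set X)) (Set.notMem_empty _)
  · conv_lhs => rw [← h]
    exact g.injective.mem_set_image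

/-- Every nonempty block is a left coset of a `ψ`-invariant subgroup. -/
theorem IsBlockLQ.exists_eq_leftCoset {G : Type*} [Group G] {φ : G ≃ G} {ψ : G ≃* G}
    {Y : Set G} (hY : IsBlockLQ (rlSigma φ ψ) Y) {y : G} (hy : y ∈ Y) :
    ∃ H : Subgroup G, (∀ g : G, g ∈ H ↔ ψ g ∈ H) ∧ Y = (fun h => y * h) '' (H : Set G) := by
  have key : ∀ g ∈ permGroup (rlSigma φ ψ), y * g 1 ∈ Y → ∀ w, y * g w ∈ Y ↔ y * w ∈ Y := by
    intro g hg h w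
    have hmem := mul_mem (mul_mem (mulLeft_mem_permGroup φ ψ y) hg)
      (mulLeft_mem_permGroup φ ψ y⁻¹)
    simpa using hY.apply_mem_iff hmem hy (by simpa using h) (y * w)
  have keyMul : ∀ a, y * a ∈ Y → ∀ w, y * (a * w) ∈ Y ↔ y * w ∈ Y := fun a ha w => by
    simpa using key _ (mulLeft_mem_permGroup φ ψ a) (by simpa using ha) w
  refine ⟨{ carrier := {h | y * h ∈ Y}
            one_mem' := by simpa using hy
            mul_mem' := fun {a b} ha hb => (keyMul a ha b).2 hb
            inv_mem' := fun {a} ha => (keyMul a ha a⁻¹).1 (by simpa using hy) }, fun g => ?_, ?_⟩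
  · simpa using (key _ (mulEquiv_mem_permGroup φ ψ) (by simpa using hy) g).symm
  · rw [Set.image_mul_left]
    ext z
    simp

/-- for a finite latin left quasigroup right linear over `(G,∘)` via
`x·y = φ(x) ∘ ψ(y)` (`φ` a bijection, `ψ` an automorphism), the assignment
`H ↦ {x∘H : x ∈ G}` is a bijection from the set of subgroups of `G` invariant under
`ψ` onto the set of complete block systems for the action of `G(X)` on `X`. -/
theorem stmt_5 {G : Type*} [Group G] [Finite G] (φ : G ≃ G) (ψ : G ≃* G) :
    Set.BijOn
      (fun H : Subgroup G => {Z : Set G | ∃ x : G, Z = (fun h => x * h) '' (H : Set G)})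
      {H : Subgroup G | ∀ g : G, g ∈ H ↔ ψ g ∈ H}
      {P : Set (Set G) | IsCompleteBlockSystem (rlSigma φ ψ) P} := by
  have isSystem : ∀ {H : Subgroup G}, (∀ g : G, g ∈ H ↔ ψ g ∈ H) → ∀ y : G,
      {Z : Set G | ∃ x : G, Z = (fun h => x * h) '' (H : Set G)} =
        {Z | ∃ g ∈ permGroup (rlSigma φ ψ), Z = ⇑g '' ((fun h => y * h) '' (H : Set G))} := by
    intro H hH y
    ext Z
    constructor
    · rintro ⟨x, rfl⟩
      have hx := mulLeft_mem_permGroup φ ψ (x * y⁻¹)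
      exact ⟨_, hx, by rw [image_leftCoset_of_mem_permGroup hH hx]; simp⟩
    · rintro ⟨g, hg, rfl⟩
      exact ⟨g y, image_leftCoset_of_mem_permGroup hH hg y⟩
  refine ⟨fun H hH => ?_, fun H _ K _ hHK => ?_, ?_⟩
  · refine ⟨(fun h => 1 * h) '' (H : Set G), ⟨1, 1, H.one_mem, one_mul 1⟩, fun g hg => ?_,
      isSystem hH 1⟩
    rw [image_leftCoset_of_mem_permGroup hH hg, Set.image_mul_left, Set.image_mul_left]
    by_cases h : g 1 ∈ H
    · right
      ext z
      simp [H.mul_mem_cancel_left (H.inv_mem h)]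
    · left
      ext z
      simp only [Set.mem_inter_iff, Set.mem_preimage, SetLike.mem_coe, inv_one, one_mul,
        Set.mem_empty_iff_false, iff_false, not_and]
      intro hz hz'
      exact h (by simpa using (H.mul_mem_cancel_right hz').1 hz)
  · have hmem : (H : Set G) ∈ {Z : Set G | ∃ x : G, Z = (fun h => x * h) '' (K : Set G)} :=
      (Set.ext_iff.1 hHK H).1 ⟨1, by simp⟩
    obtain ⟨x, hx⟩ := hmem
    rw [Set.image_mul_left] at hx
    have hmemIff : ∀ z, z ∈ H ↔ x⁻¹ * z ∈ K := fun z => Set.ext_iff.1 hx z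
    have hxK : x⁻¹ ∈ K := by simpa using (hmemIff 1).1 H.one_mem
    ext z
    rw [hmemIff, K.mul_mem_cancel_left hxK]
  · rintro P ⟨Y, ⟨y, hy⟩, hY, rfl⟩
    obtain ⟨H, hH, rfl⟩ := hY.exists_eq_leftCoset hy
    exact ⟨H, hH, isSystem hH y⟩
end

section
/- Let X be a finite latin left quasigroup that is right linear over a group (G,∘), i.e. X = G and x·y = φ(x) ∘ ψ(y) for a bijection φ of G and an automorphism ψ of (G,∘). Then the assignment H ↦ (the relation x ~ y ⇔ x⁻¹ ∘ y ∈ H) is a bijection from the set of normal subgroups H of G that are invariant under ψ and invariant under φ onto the set of congruences of X. -/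
/-- A (normal) subgroup `H` of `G` is invariant under a map `f : G → G` if
`x⁻¹∘y ∈ H` implies `f(x)⁻¹∘f(y) ∈ H`. -/
def InvariantUnder {G : Type*} [Group G] (H : Subgroup G) (f : G → G) : Prop :=
  ∀ x y : G, x⁻¹ * y ∈ H → (f x)⁻¹ * f y ∈ H

/-- A permutation of a finite type that preserves a relation also reflects it. -/
theorem rel_symm_of_rel_map {X : Type*} [Finite X] (e : Equiv.Perm X) (r : X → X → Prop)
    (h : ∀ x y, r x y → r (e x) (e y)) {x y : X} (hxy : r x y) :
    r (e.symm x) (e.symm y) := by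
  have hpow : ∀ (n : ℕ) (x y : X), r x y → r ((e ^ n) x) ((e ^ n) y) := by
    intro n
    induction n with
    | zero => exact fun x y hr => hr
    | succ n ih =>
      intro x y hr
      rw [pow_succ]
      exact ih _ _ (h _ _ hr)
  have hinv : e ^ (orderOf e - 1) = e⁻¹ := by
    rw [eq_inv_iff_mul_eq_one, ← pow_succ, Nat.sub_add_cancel (orderOf_pos e), pow_orderOf_eq_one]
  have := hpow (orderOf e - 1) x y hxy
  rwa [hinv] at this

@[simp]
theorem rlSigma_apply {G : Type*} [Group G] (φ : G ≃ G) (ψ : G ≃* G) (x y : G) :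
    rlSigma φ ψ x y = φ x * ψ y := rfl

@[simp]
theorem rlSigma_symm_apply {G : Type*} [Group G] (φ : G ≃ G) (ψ : G ≃* G) (x y : G) :
    (rlSigma φ ψ x).symm y = ψ.symm ((φ x)⁻¹ * y) := rfl

/-- The left coset relation of a normal subgroup is compatible with multiplication. -/
theorem Subgroup.Normal.inv_mul_mem_mul {G : Type*} [Group G] {H : Subgroup G} (hH : H.Normal)
    {a b c d : G} (hab : a⁻¹ * b ∈ H) (hcd : c⁻¹ * d ∈ H) : (a * c)⁻¹ * (b * d) ∈ H := by
  rw [← QuotientGroup.eq] at *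
  simp only [QuotientGroup.mk_mul, hab, hcd]

/-- The left coset relation of a normal subgroup is compatible with inversion. -/
theorem Subgroup.Normal.inv_mul_mem_inv {G : Type*} [Group G] {H : Subgroup G} (hH : H.Normal)
    {a b : G} (hab : a⁻¹ * b ∈ H) : (a⁻¹)⁻¹ * b⁻¹ ∈ H := by
  rw [← QuotientGroup.eq] at *
  simp only [QuotientGroup.mk_inv, hab]

/-- An invariant normal subgroup induces a congruence. -/
theorem isCongruence_of_invariantUnder {G : Type*} [Group G] [Finite G] {φ : G ≃ G} {ψ : G ≃* G}
    {H : Subgroup G} (hH : H.Normal) (hψ : InvariantUnder H ψ) (hφ : InvariantUnder H φ) :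
    IsCongruence (rlSigma φ ψ) fun x y => x⁻¹ * y ∈ H := by
  refine ⟨⟨fun x => by simp, fun {x y} h => ?_, fun {x y z} h h' => ?_⟩,
    fun x x' y y' hx hy => ?_, fun x x' y y' hx hy => ?_⟩
  · simpa using H.inv_mem h
  · simpa [mul_assoc] using H.mul_mem h h'
  · exact hH.inv_mul_mem_mul (hφ _ _ hx) (hψ _ _ hy)
  · exact rel_symm_of_rel_map ψ.toEquiv (fun x y => x⁻¹ * y ∈ H) hψ
      (hH.inv_mul_mem_mul (hH.inv_mul_mem_inv (hφ _ _ hx)) hy)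

namespace IsCongruence

variable {G : Type*} [Group G] {φ : G ≃ G} {ψ : G ≃* G} {r : G → G → Prop}

theorem rel_map_mulEquiv (h : IsCongruence (rlSigma φ ψ) r) {x y : G} (hxy : r x y) :
    r (ψ x) (ψ y) := by
  simpa using h.2.1 (φ.symm 1) _ x y (h.1.refl _) hxy

theorem rel_mul_left (h : IsCongruence (rlSigma φ ψ) r) (g : G) {x y : G} (hxy : r x y) :
    r (g * x) (g * y) := by
  have hψ : r (ψ.symm x) (ψ.symm y) := by
    simpa using h.2.2 (φ.symm 1) _ x y (h.1.refl _) hxy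
  simpa using h.2.1 (φ.symm g) _ _ _ (h.1.refl _) hψ

theorem rel_map_equiv (h : IsCongruence (rlSigma φ ψ) r) {x y : G} (hxy : r x y) :
    r (φ x) (φ y) := by
  simpa using h.2.1 x y 1 1 hxy (h.1.refl _)

theorem rel_mul_right [Finite G] (h : IsCongruence (rlSigma φ ψ) r) (g : G) {x y : G}
    (hxy : r x y) : r (x * g) (y * g) := by
  have hφ := rel_symm_of_rel_map φ r (fun _ _ => h.rel_map_equiv) hxy
  simpa using h.2.1 _ _ (ψ.symm g) _ hφ (h.1.refl _)

/-- The class of the identity of a congruence, as a subgroup. -/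
def oneClass (h : IsCongruence (rlSigma φ ψ) r) : Subgroup G where
  carrier := {x | r 1 x}
  one_mem' := h.1.refl 1
  mul_mem' {a b} ha hb := h.1.trans ha (by simpa using h.rel_mul_left a hb)
  inv_mem' {a} ha := h.1.symm (by simpa using h.rel_mul_left a⁻¹ ha)

theorem inv_mul_mem_oneClass (h : IsCongruence (rlSigma φ ψ) r) {x y : G} :
    x⁻¹ * y ∈ h.oneClass ↔ r x y := by
  change r 1 (x⁻¹ * y) ↔ r x y
  exact ⟨fun hr => by simpa using h.rel_mul_left x hr,
    fun hr => by simpa using h.rel_mul_left x⁻¹ hr⟩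

theorem oneClass_normal [Finite G] (h : IsCongruence (rlSigma φ ψ) r) : h.oneClass.Normal where
  conj_mem x hx g := by
    change r 1 (g * x * g⁻¹)
    simpa using h.rel_mul_right g⁻¹ (h.rel_mul_left g hx)

end IsCongruence

/-- for a finite latin left quasigroup right linear over `(G,∘)` via
`x·y = φ(x) ∘ ψ(y)` (`φ` a bijection, `ψ` an automorphism), the assignment
`H ↦ (x ~ y ⇔ x⁻¹∘y ∈ H)` is a bijection from the set of normal subgroups of `G`
invariant under `ψ` and under `φ` onto the set of congruences of `X`. -/
theorem stmt_6 {G : Type*} [Group G] [Finite G] (φ : G ≃ G) (ψ : G ≃* G) :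
    Set.BijOn
      (fun H : Subgroup G => fun x y : G => x⁻¹ * y ∈ H)
      {H : Subgroup G | H.Normal ∧ InvariantUnder H ⇑ψ ∧ InvariantUnder H ⇑φ}
      {r : G → G → Prop | IsCongruence (rlSigma φ ψ) r} := by
  refine ⟨fun H hH => isCongruence_of_invariantUnder hH.1 hH.2.1 hH.2.2,
    fun H _ K _ hHK => ?_, fun r hr => ?_⟩
  · ext x
    simpa using congrFun (congrFun hHK 1) x
  · have hr : IsCongruence (rlSigma φ ψ) r := hr
    refine ⟨hr.oneClass, ⟨hr.oneClass_normal, fun x y hxy => ?_, fun x y hxy => ?_⟩, ?_⟩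
    · exact hr.inv_mul_mem_oneClass.2 (hr.rel_map_mulEquiv (hr.inv_mul_mem_oneClass.1 hxy))
    · exact hr.inv_mul_mem_oneClass.2 (hr.rel_map_equiv (hr.inv_mul_mem_oneClass.1 hxy))
    · funext x y
      exact propext hr.inv_mul_mem_oneClass
end

section
/- Let X be a finite simple non-degenerate cycle set whose displacement group Dis(X) is nilpotent. Then |X| = p^k for some prime number p and some natural number k. -/
section RegularAbelian

variable {G : Type*} [Group G] (A : Subgroup (Equiv.Perm G)) (D : Subgroup G)

/-- The permutations in `A` that preserve every coset `D * g`. -/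
def cosetStabilizer : Subgroup (Equiv.Perm G) where
  carrier := {T | T ∈ A ∧ ∀ g, T g * g⁻¹ ∈ D}
  one_mem' := ⟨A.one_mem, fun g => by simp⟩
  mul_mem' := by
    rintro S T ⟨hS, hS'⟩ ⟨hT, hT'⟩
    refine ⟨A.mul_mem hS hT, fun g => ?_⟩
    have h := D.mul_mem (hS' (T g)) (hT' g)
    simpa [mul_assoc] using h
  inv_mem' := by
    rintro T ⟨hT, hT'⟩
    refine ⟨A.inv_mem hT, fun g => ?_⟩
    have h := D.inv_mem (hT' (T⁻¹ g))
    simpa using h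

variable {A D}

theorem conj_mulRight_apply (T : Equiv.Perm G) (g h : G) :
    ((Equiv.mulRight g)⁻¹ * T * Equiv.mulRight g) h = T (h * g) * g⁻¹ := by
  simp [Equiv.Perm.mul_apply, Equiv.Perm.inv_def]

theorem conj_mulRight_mem_cosetStabilizer
    (hconj : ∀ T ∈ A, ∀ g, (Equiv.mulRight g)⁻¹ * T * Equiv.mulRight g ∈ A)
    {T : Equiv.Perm G} (hT : T ∈ cosetStabilizer A D) (g : G) :
    (Equiv.mulRight g)⁻¹ * T * Equiv.mulRight g ∈ cosetStabilizer A D := by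
  refine ⟨hconj T hT.1 g, fun h => ?_⟩
  have := hT.2 (h * g)
  rw [conj_mulRight_apply]
  simpa [mul_assoc] using this

theorem eq_of_apply_one_eq (hcomm : ∀ S ∈ A, ∀ T ∈ A, S * T = T * S)
    (htrans : ∀ g, ∃ U ∈ A, U 1 = g) {S T : Equiv.Perm G} (hS : S ∈ A) (hT : T ∈ A)
    (h : S 1 = T 1) : S = T := by
  ext g
  obtain ⟨U, hU, rfl⟩ := htrans g
  rw [← Equiv.Perm.mul_apply, ← Equiv.Perm.mul_apply, hcomm S hS U hU, hcomm T hT U hU,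
    Equiv.Perm.mul_apply, Equiv.Perm.mul_apply, h]

theorem card_cosetStabilizer [D.Normal] (hcomm : ∀ S ∈ A, ∀ T ∈ A, S * T = T * S)
    (htrans : ∀ g, ∃ U ∈ A, U 1 = g)
    (hD : ∀ U ∈ A, ∃ c : G ⧸ D, ∀ g, ((U g : G) : G ⧸ D) = c * (g : G ⧸ D)) :
    Nat.card (cosetStabilizer A D) = Nat.card D := by
  refine Nat.card_congr (Equiv.ofBijective
    (fun T => ⟨T.1 1, by simpa using T.2.2 1⟩) ⟨fun S T h => ?_, fun d => ?_⟩)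
  · exact Subtype.ext (eq_of_apply_one_eq hcomm htrans S.2.1 T.2.1 (Subtype.ext_iff.1 h))
  · obtain ⟨U, hU, hd⟩ := htrans d
    obtain ⟨c, hc⟩ := hD U hU
    have h1 : ((d : G) : G ⧸ D) = 1 := (QuotientGroup.eq_one_iff _).2 d.2
    have hc1 : c = 1 := by
      have := hc 1
      rw [hd, h1] at this
      simpa using this.symm
    refine ⟨⟨U, hU, fun g => ?_⟩, Subtype.ext hd⟩
    rw [← QuotientGroup.eq_one_iff, QuotientGroup.mk_mul, hc, hc1]
    simp

/-- An abelian regular group `A` of permutations of a finite group `G`, normalized by the right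
translations, makes the Sylow subgroups of a nilpotent normal subgroup `D` compatible with `A`
as soon as `A` acts on `G ⧸ D` by translations. -/
theorem exists_normal_sylow_compatible [Finite G] [D.Normal] [Group.IsNilpotent D]
    (hcomm : ∀ S ∈ A, ∀ T ∈ A, S * T = T * S)
    (htrans : ∀ g, ∃ U ∈ A, U 1 = g)
    (hconj : ∀ T ∈ A, ∀ g, (Equiv.mulRight g)⁻¹ * T * Equiv.mulRight g ∈ A)
    (hD : ∀ U ∈ A, ∃ c : G ⧸ D, ∀ g, ((U g : G) : G ⧸ D) = c * (g : G ⧸ D))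
    (p : ℕ) [Fact p.Prime] :
    ∃ P : Subgroup G, P.Normal ∧ Nat.card P = p ^ (Nat.card D).factorization p ∧
      ∀ g ∈ P, ∀ T ∈ A, T g * (T 1)⁻¹ ∈ P := by
  obtain ⟨S⟩ : Nonempty (Sylow p (cosetStabilizer A D)) := inferInstance
  have hSn : (S : Subgroup (cosetStabilizer A D)).Normal := ⟨fun n hn g => by
    have : g * n = n * g := Subtype.ext (hcomm _ g.2.1 _ n.2.1)
    rwa [this, mul_inv_cancel_right]⟩
  have hSub : Subsingleton (Sylow p (cosetStabilizer A D)) :=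
    (Sylow.unique_of_normal S hSn).instSubsingleton
  have hS : ∀ T : cosetStabilizer A D, T ∈ S ↔ ∃ k, T ^ p ^ k = 1 := by
    refine fun T => ⟨fun hT => ?_, fun ⟨k, hk⟩ => ?_⟩
    · obtain ⟨k, hk⟩ := S.2 ⟨T, hT⟩
      exact ⟨k, Subtype.ext_iff.1 hk⟩
    · have hz : IsPGroup p (Subgroup.zpowers T) := by
        rintro ⟨_, n, rfl⟩
        refine ⟨k, Subtype.ext ?_⟩
        have : (T ^ n) ^ p ^ k = (T ^ p ^ k) ^ n := by
          rw [← zpow_natCast, ← zpow_natCast, zpow_comm]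
        simpa [hk] using this
      obtain ⟨Q, hQ⟩ := hz.exists_le_sylow
      rw [Subsingleton.elim S Q]
      exact hQ (Subgroup.mem_zpowers T)
  have hSconj : ∀ T ∈ (S : Subgroup (cosetStabilizer A D)), ∀ g,
      ∃ T' ∈ (S : Subgroup (cosetStabilizer A D)), ∀ h, T.1 (h * g) = T'.1 h * g := by
    intro T hT g
    refine ⟨⟨_, conj_mulRight_mem_cosetStabilizer hconj T.2 g⟩, ?_, fun h => ?_⟩
    · obtain ⟨k, hk⟩ := (hS T).1 hT
      refine (hS _).2 ⟨k, Subtype.ext ?_⟩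
      have hk' : T.1 ^ p ^ k = 1 := by simpa using congrArg Subtype.val hk
      have := conj_pow (i := p ^ k) (a := (Equiv.mulRight g)⁻¹) (b := T.1)
      rw [inv_inv] at this
      change ((Equiv.mulRight g)⁻¹ * T.1 * Equiv.mulRight g) ^ p ^ k = 1
      rw [this, hk', mul_one, inv_mul_cancel]
    · simp only [conj_mulRight_apply, inv_mul_cancel_right]
  let P : Subgroup G :=
    { carrier := {g | ∃ T ∈ (S : Subgroup (cosetStabilizer A D)), T.1 1 = g}
      one_mem' := ⟨1, S.one_mem, rfl⟩
      mul_mem' := by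
        rintro _ _ ⟨T, hT, rfl⟩ ⟨U, hU, rfl⟩
        obtain ⟨T', hT', h⟩ := hSconj T hT (U.1 1)⁻¹
        refine ⟨T' * U, mul_mem hT' hU, ?_⟩
        have := h (U.1 1)
        rw [mul_inv_cancel] at this
        rw [this, inv_mul_cancel_right]
        rfl
      inv_mem' := by
        rintro _ ⟨T, hT, rfl⟩
        obtain ⟨T', hT', h⟩ := hSconj T⁻¹ (inv_mem hT) (T.1 1)
        refine ⟨T', hT', eq_inv_of_mul_eq_one_left ?_⟩
        rw [← h 1, one_mul]
        exact T.1.symm_apply_apply 1 }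
  have hPcard : Nat.card P = p ^ (Nat.card D).factorization p := by
    rw [← card_cosetStabilizer hcomm htrans hD, ← S.card_eq_multiplicity]
    refine (Nat.card_congr (Equiv.ofBijective (fun T => ⟨T.1.1 1, T.1, T.2, rfl⟩)
      ⟨fun T U h => ?_, ?_⟩)).symm
    · exact Subtype.ext (Subtype.ext
        (eq_of_apply_one_eq hcomm htrans T.1.2.1 U.1.2.1 (Subtype.ext_iff.1 h)))
    · rintro ⟨_, T, hT, rfl⟩
      exact ⟨⟨T, hT⟩, rfl⟩
  have hPD : P ≤ D := by
    rintro _ ⟨T, -, rfl⟩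
    simpa using T.2.2 1
  refine ⟨P, ?_, hPcard, ?_⟩
  · have hc : Nat.card (P.subgroupOf D) = p ^ (Nat.card D).factorization p := by
      rw [← hPcard]
      exact Nat.card_congr (Subgroup.subgroupOfEquivOfLe hPD).toEquiv
    let Q : Sylow p D := Sylow.ofCard (P.subgroupOf D) hc
    have hQ : (Q : Subgroup D).Normal :=
      ((Group.isNilpotent_of_finite_tfae (G := D)).out 0 3 rfl rfl).1 ‹_› p ‹_› Q
    have hQ' : (P.subgroupOf D).Characteristic := Q.characteristic_of_normal hQ
    have := ConjAct.normal_of_characteristic_of_normal (H := D) (K := P.subgroupOf D)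
    rwa [Subgroup.map_subgroupOf_eq_of_le hPD] at this
  · rintro _ ⟨U, hU, rfl⟩ T hT
    obtain ⟨U', hU', h⟩ := hSconj U hU (T 1)
    refine ⟨U', hU', ?_⟩
    have := h 1
    rw [one_mul, ← Equiv.Perm.mul_apply, hcomm _ U.2.1 T hT, Equiv.Perm.mul_apply] at this
    rw [this, mul_inv_cancel_right]

end RegularAbelian

section CycleSet

variable {X : Type*} {σ : X → Equiv.Perm X}

theorem sigmaG_smul (x y : X) : sigmaG σ x • y = σ x y := rfl

instance dis_normal : (dis σ).Normal := Subgroup.normalClosure_normal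

theorem sigmaG_mul_inv_mem_dis (x y : X) : sigmaG σ x * (sigmaG σ y)⁻¹ ∈ dis σ :=
  Subgroup.subset_normalClosure ⟨x, y, rfl⟩

/-- In a simple left quasigroup, a normal `p`-subgroup of `G(X)` whose orbits form a congruence
forces the cardinality to be a power of `p`. -/
theorem card_eq_prime_pow_of_normal [Finite X] [Nonempty X] (hs : SimpleLQ σ) {p k : ℕ}
    (hp : p.Prime) (N : Subgroup (permGroup σ)) [N.Normal] (hcard : Nat.card N = p ^ k)
    (hk : k ≠ 0) (hN : ∀ g ∈ N, ∀ x : X, sigmaG σ (g • x) * (sigmaG σ x)⁻¹ ∈ N) :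
    ∃ k, Nat.card X = p ^ k := by
  have hn : N.Normal := inferInstance
  have hcong : IsCongruence σ fun x y => ∃ g ∈ N, g • x = y := by
    refine ⟨⟨fun x => ⟨1, N.one_mem, one_smul _ x⟩, ?_, ?_⟩, ?_, ?_⟩
    · rintro x _ ⟨g, hg, rfl⟩
      exact ⟨g⁻¹, N.inv_mem hg, inv_smul_smul g x⟩
    · rintro x _ _ ⟨g, hg, rfl⟩ ⟨h, hh, rfl⟩
      exact ⟨h * g, N.mul_mem hh hg, mul_smul h g x⟩
    · rintro x _ y _ ⟨g, hg, rfl⟩ ⟨h, hh, rfl⟩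
      refine ⟨_, N.mul_mem (hN g hg x) (hn.conj_mem h hh (sigmaG σ x)), ?_⟩
      simp only [← sigmaG_smul, smul_smul]
      congr 1
      group
    · rintro x _ y _ ⟨g, hg, rfl⟩ ⟨h, hh, rfl⟩
      refine ⟨_, hn.conj_mem _ (N.mul_mem hh (N.inv_mem (hN g hg x)))
        (sigmaG σ (g • x))⁻¹, ?_⟩
      change _ • ((sigmaG σ x)⁻¹ • y) = (sigmaG σ (g • x))⁻¹ • (h • y)
      simp only [smul_smul]
      congr 1
      group
  rcases hs.2 _ hcong with h | h
  · have hbot : N = ⊥ := by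
      refine (Subgroup.eq_bot_iff_forall N).2 fun g hg => ?_
      refine Subtype.ext (Equiv.ext fun x => ?_)
      exact ((h x (g • x)).1 ⟨g, hg, rfl⟩).symm
    rw [hbot, Subgroup.card_bot] at hcard
    exact absurd hcard.symm (Nat.one_lt_pow hk hp.one_lt).ne'
  · obtain ⟨x⟩ := ‹Nonempty X›
    have : MulAction.IsPretransitive N X := MulAction.isPretransitive_iff_orbit_eq_univ x |>.2 <| by
      refine Set.eq_univ_of_forall fun y => ?_
      obtain ⟨g, hg, hgy⟩ := h x y
      exact ⟨⟨g, hg⟩, hgy⟩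
    have hdvd : Nat.card X ∣ p ^ k := by
      rw [← hcard, ← MulAction.index_stabilizer_of_transitive N x]
      exact Subgroup.index_dvd_card _
    obtain ⟨j, -, hj⟩ := (Nat.dvd_prime_pow hp).1 hdvd
    exact ⟨j, hj⟩

/-- The map `g ↦ σ_{g(y)} g` on `G(X)`: addition of the generator `y` in the brace on `G(X)`. -/
noncomputable def addGen [Finite X] (hnd : Nondeg σ) (y : X) : Equiv.Perm (permGroup σ) :=
  Equiv.ofBijective (fun g => sigmaG σ (g • y) * g) <| Finite.injective_iff_bijective.1 <| by
    intro g h hgh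
    have hy : g • y = h • y := by
      apply hnd.1
      have := congrArg (· • y) hgh
      simpa only [mul_smul, sigmaG_smul] using this
    simpa [hy] using hgh

variable [Finite X] (hnd : Nondeg σ)

theorem addGen_apply (y : X) (g : permGroup σ) : addGen hnd y g = sigmaG σ (g • y) * g := rfl

/-- The group of additive translations of the brace `G(X)`. -/
noncomputable def addTranslations : Subgroup (Equiv.Perm (permGroup σ)) :=
  Subgroup.closure (Set.range (addGen hnd))

theorem addGen_mem (y : X) : addGen hnd y ∈ addTranslations hnd :=
  Subgroup.subset_closure ⟨y, rfl⟩

theorem addGen_comm (hlaw : CycleSetLaw σ) (y z : X) :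
    addGen hnd y * addGen hnd z = addGen hnd z * addGen hnd y := by
  refine Equiv.ext fun g => Subtype.ext (Equiv.ext fun t => ?_)
  exact hlaw (g • z) (g • y) (g • t)

theorem addTranslations_comm (hlaw : CycleSetLaw σ) :
    ∀ S ∈ addTranslations hnd, ∀ T ∈ addTranslations hnd, S * T = T * S := by
  have h := Subgroup.isMulCommutative_closure (k := Set.range (addGen hnd)) (by
    rintro _ ⟨y, rfl⟩ _ ⟨z, rfl⟩
    exact addGen_comm hnd hlaw y z)
  intro S hS T hT
  exact Subtype.ext_iff.1 (h.is_comm.comm (⟨S, hS⟩ : addTranslations hnd) ⟨T, hT⟩)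

theorem addTranslations_transitive (g : permGroup σ) : ∃ U ∈ addTranslations hnd, U 1 = g := by
  obtain ⟨g, hg⟩ := g
  induction hg using Subgroup.closure_induction_left with
  | one => exact ⟨1, one_mem _, rfl⟩
  | mul_left x hx h hh ih =>
    obtain ⟨x, rfl⟩ := hx
    obtain ⟨U, hU, hUh⟩ := ih
    refine ⟨addGen hnd ((U 1)⁻¹ • x) * U, mul_mem (addGen_mem hnd _) hU, ?_⟩
    rw [Equiv.Perm.mul_apply, addGen_apply, smul_inv_smul, hUh]
    rfl
  | inv_mul_cancel x hx h hh ih =>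
    obtain ⟨x, rfl⟩ := hx
    obtain ⟨U, hU, hUh⟩ := ih
    refine ⟨(addGen hnd (((sigmaG σ x)⁻¹ * U 1)⁻¹ • x))⁻¹ * U,
      mul_mem (inv_mem (addGen_mem hnd _)) hU, ?_⟩
    have h1 : U 1 = addGen hnd (((sigmaG σ x)⁻¹ * U 1)⁻¹ • x) ((sigmaG σ x)⁻¹ * U 1) := by
      rw [addGen_apply, smul_inv_smul, mul_inv_cancel_left]
    rw [Equiv.Perm.mul_apply, Equiv.Perm.inv_eq_iff_eq, hUh]
    rw [hUh] at h1
    exact h1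

theorem conj_mulRight_mem_addTranslations :
    ∀ T ∈ addTranslations hnd, ∀ g,
      (Equiv.mulRight g)⁻¹ * T * Equiv.mulRight g ∈ addTranslations hnd := by
  intro T hT g
  induction hT using Subgroup.closure_induction with
  | mem T hT =>
    obtain ⟨y, rfl⟩ := hT
    convert addGen_mem hnd (g • y) using 1
    ext1 h
    rw [conj_mulRight_apply, addGen_apply, addGen_apply, mul_smul, ← mul_assoc,
      mul_inv_cancel_right]
  | one =>
    rw [mul_one, inv_mul_cancel]
    exact one_mem _
  | mul S T _ _ hS hT =>
    convert mul_mem hS hT using 1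
    group
  | inv T _ hT =>
    convert inv_mem hT using 1
    group

theorem addTranslations_quotient_dis :
    ∀ U ∈ addTranslations hnd, ∃ c : permGroup σ ⧸ dis σ,
      ∀ g, ((U g : permGroup σ) : permGroup σ ⧸ dis σ) = c * (g : permGroup σ ⧸ dis σ) := by
  intro U hU
  induction hU using Subgroup.closure_induction with
  | mem U hU =>
    obtain ⟨y, rfl⟩ := hU
    refine ⟨(sigmaG σ y : permGroup σ), fun g => ?_⟩
    rw [addGen_apply, QuotientGroup.mk_mul]
    congr 1
    have := (QuotientGroup.eq_one_iff _).2 (sigmaG_mul_inv_mem_dis (σ := σ) (g • y) y)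
    rwa [QuotientGroup.mk_mul, QuotientGroup.mk_inv, mul_inv_eq_one] at this
  | one => exact ⟨1, fun g => by simp⟩
  | mul S T _ _ hS hT =>
    obtain ⟨c, hc⟩ := hS
    obtain ⟨d, hd⟩ := hT
    exact ⟨c * d, fun g => by rw [Equiv.Perm.mul_apply, hc, hd, mul_assoc]⟩
  | inv T _ hT =>
    obtain ⟨c, hc⟩ := hT
    refine ⟨c⁻¹, fun g => ?_⟩
    rw [eq_inv_mul_iff_mul_eq, ← hc]
    exact congrArg _ (T.apply_symm_apply g)

theorem sigmaG_mul_inv_mem_of_addTranslations {P : Subgroup (permGroup σ)} [hP : P.Normal]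
    (h : ∀ g ∈ P, ∀ T ∈ addTranslations hnd, T g * (T 1)⁻¹ ∈ P) :
    ∀ g ∈ P, ∀ x : X, sigmaG σ (g • x) * (sigmaG σ x)⁻¹ ∈ P := by
  intro g hg x
  have := P.mul_mem (h g hg _ (addGen_mem hnd x))
    (hP.conj_mem _ (P.inv_mem hg) (addGen hnd x 1))
  convert this using 1
  simp only [addGen_apply, one_smul, mul_one]
  group

end CycleSet

/-- a finite simple non-degenerate cycle set with nilpotent displacement
group has prime-power cardinality. -/
theorem stmt_8 {X : Type*} [Finite X] [Nonempty X] (σ : X → Equiv.Perm X)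
    (hlaw : CycleSetLaw σ) (hnd : Nondeg σ) (hs : SimpleLQ σ)
    (hnil : Group.IsNilpotent ↥(dis σ)) :
    ∃ p k : ℕ, p.Prime ∧ Nat.card X = p ^ k := by
  by_cases hbot : dis σ = ⊥
  · have hσ : ∀ x y, sigmaG σ x = sigmaG σ y := fun x y => by
      have := sigmaG_mul_inv_mem_dis (σ := σ) x y
      rwa [hbot, Subgroup.mem_bot, mul_inv_eq_one] at this
    have hcomm : IsMulCommutative (permGroup σ) := Subgroup.isMulCommutative_closure (by
      rintro _ ⟨x, rfl⟩ _ ⟨y, rfl⟩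
      have : σ x = σ y := Subtype.ext_iff.1 (hσ x y)
      rw [this])
    by_cases hG : Nat.card (permGroup σ) = 1
    · refine ⟨2, 0, Nat.prime_two, ?_⟩
      have : Subsingleton (permGroup σ) := (Nat.card_eq_one_iff_unique.1 hG).1
      rw [pow_zero, Nat.card_eq_one_iff_unique]
      refine ⟨⟨fun x y => ?_⟩, inferInstance⟩
      obtain ⟨g, hg, rfl⟩ := hs.1 x y
      have : g = 1 := Subtype.ext_iff.1 (Subsingleton.elim (⟨g, hg⟩ : permGroup σ) 1)
      simp [this]
    · obtain ⟨p, hp, hdvd⟩ := Nat.exists_prime_and_dvd hG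
      have := Fact.mk hp
      obtain ⟨S⟩ : Nonempty (Sylow p (permGroup σ)) := inferInstance
      have hn : (S : Subgroup (permGroup σ)).Normal := ⟨fun n hn g => by
        rwa [hcomm.is_comm.comm g n, mul_inv_cancel_right]⟩
      obtain ⟨k, hk⟩ := card_eq_prime_pow_of_normal hs hp S S.card_eq_multiplicity
        (hp.factorization_pos_of_dvd Nat.card_pos.ne' hdvd).ne' fun g _ x => by
          rw [hσ (g • x) x, mul_inv_cancel]
          exact one_mem _
      exact ⟨p, k, hp, hk⟩
  · obtain ⟨p, hp, hdvd⟩ := Nat.exists_prime_and_dvd (mt (dis σ).card_eq_one.1 hbot)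
    have := Fact.mk hp
    obtain ⟨P, hPn, hPc, hP⟩ := exists_normal_sylow_compatible (addTranslations_comm hnd hlaw)
      (addTranslations_transitive hnd) (conj_mulRight_mem_addTranslations hnd)
      (addTranslations_quotient_dis hnd) p
    obtain ⟨k, hk⟩ := card_eq_prime_pow_of_normal hs hp P hPc
      (hp.factorization_pos_of_dvd Nat.card_pos.ne' hdvd).ne'
      (sigmaG_mul_inv_mem_of_addTranslations hnd hP)
    exact ⟨p, k, hp, hk⟩
end

section
/- Let X be a finite latin non-degenerate cycle set whose displacement group Dis(X) is cyclic. Then |X| = 1. -/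
open Equiv in
/-- Adding `x` to `g` in the brace structure of the permutation group. -/
def braceAdd {X : Type*} (σ : X → Perm X) (x : X) (g : Perm X) : Perm X :=
  σ (g x) * g

open Equiv in
theorem braceAdd_comm {X : Type*} {σ : X → Perm X} (hlaw : CycleSetLaw σ) (x y : X)
    (g : Perm X) :
    braceAdd σ x (braceAdd σ y g) = braceAdd σ y (braceAdd σ x g) := by
  ext z
  exact hlaw (g y) (g x) (g z)

open Equiv in
/-- Telescoping along a `τ`-orbit in the additive group generated by the maps `braceAdd σ x`:
the difference of `u` and `τ⁻ᵐ u` is a coboundary for the action of `τ`. -/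
theorem exists_telescope {X : Type*} {σ : X → Perm X} (hlaw : CycleSetLaw σ) (τ : Perm X)
    (u : X) (m : ℕ) :
    ∃ P : Perm X → Perm X, (∀ x g, P (braceAdd σ x g) = braceAdd σ x (P g)) ∧
      ∀ g, P (braceAdd σ u g * τ⁻¹) * τ = P (braceAdd σ ((τ⁻¹ ^ m) u) g) := by
  induction m with
  | zero => exact ⟨id, fun _ _ => rfl, fun g => by simp⟩
  | succ m ih =>
    obtain ⟨P, hP, hu⟩ := ih
    set y := (τ⁻¹ ^ m) u
    have hy : (τ⁻¹ ^ (m + 1)) u = τ⁻¹ y := by rw [pow_succ']; rfl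
    refine ⟨fun g => braceAdd σ y (P g), fun x g => ?_, fun g => ?_⟩
    · simp only [hP]
      exact braceAdd_comm hlaw y x (P g)
    · have hQ : P (braceAdd σ u g * τ⁻¹) = P (braceAdd σ y g) * τ⁻¹ :=
        eq_mul_inv_of_mul_eq (hu g)
      have hshift (Q : Perm X) : braceAdd σ y (Q * τ⁻¹) * τ = braceAdd σ (τ⁻¹ y) Q := by
        simp [braceAdd, mul_assoc]
      simp only [hQ, hy]
      rw [hshift, ← hP, braceAdd_comm hlaw, hP]

open Equiv in
/-- If `v·u` and `v·v` lie in the same orbit of `σ_u σ_v⁻¹`, then `σ_u = σ_v`. -/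
theorem sigma_mul_inv_eq_one {X : Type*} {σ : X → Perm X} (hlaw : CycleSetLaw σ) (u v : X)
    (m : ℕ) (hm : σ v u = ((σ u * (σ v)⁻¹) ^ m) (σ v v)) : σ u * (σ v)⁻¹ = 1 := by
  set τ := σ u * (σ v)⁻¹ with hτ
  obtain ⟨P, -, hP⟩ := exists_telescope hlaw τ (σ v u) m
  have h := hP (σ v)⁻¹
  have hv : (τ⁻¹ ^ m) (σ v u) = σ v v := by rw [hm, inv_pow]; simp
  have h₁ : braceAdd σ (σ v u) (σ v)⁻¹ = τ := by simp [braceAdd, hτ]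
  have h₂ : braceAdd σ (σ v v) (σ v)⁻¹ = 1 := by simp [braceAdd]
  rw [hv, h₁, h₂, mul_inv_cancel] at h
  exact mul_eq_left.mp h

theorem LatinLQ.disTransitive {X : Type*} {σ : X → Equiv.Perm X} (hlatin : LatinLQ σ) :
    DisTransitive σ := by
  intro x y
  obtain ⟨a, ha⟩ := (hlatin ((σ x)⁻¹ x)).2 y
  exact ⟨sigmaG σ a * (sigmaG σ x)⁻¹, Subgroup.subset_normalClosure ⟨a, x, rfl⟩, ha⟩

/-- a finite latin non-degenerate cycle set with cyclic displacement
group has exactly one element. -/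
theorem stmt_10 {X : Type*} [Finite X] [Nonempty X] (σ : X → Equiv.Perm X)
    (hlaw : CycleSetLaw σ) (hnd : Nondeg σ) (hlatin : LatinLQ σ)
    (hcyc : IsCyclic ↥(dis σ)) :
    Nat.card X = 1 := by
  obtain ⟨⟨⟨t, ht⟩, htd⟩, hgen⟩ := hcyc.exists_generator
  have hpow : ∀ g ∈ dis σ, ∃ k : ℤ, (g : Equiv.Perm X) = t ^ k := by
    intro g hg
    obtain ⟨k, hk⟩ := Subgroup.mem_zpowers_iff.mp (hgen ⟨g, hg⟩)
    have hval := congrArg (fun d : dis σ => ((d : permGroup σ) : Equiv.Perm X)) hk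
    exact ⟨k, by simpa using hval.symm⟩
  have htrans : ∀ x y : X, ∃ k : ℤ, (t ^ k) x = y := by
    intro x y
    obtain ⟨g, hg, hxy⟩ := hlatin.disTransitive x y
    obtain ⟨k, hk⟩ := hpow g hg
    exact ⟨k, hk ▸ hxy⟩
  obtain ⟨v⟩ := ‹Nonempty X›
  obtain ⟨u, hu⟩ := (hlatin v).2 (t (σ v v))
  obtain ⟨k, hk⟩ := hpow (sigmaG σ u * (sigmaG σ v)⁻¹)
    (Subgroup.subset_normalClosure ⟨u, v, rfl⟩)
  replace hk : σ u * (σ v)⁻¹ = t ^ k := hk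
  have huv : σ u * (σ v)⁻¹ = t := by
    rw [hk]
    ext x
    obtain ⟨j, rfl⟩ := htrans (σ v v) x
    have hbase : (t ^ k) (σ v v) = t (σ v v) := by
      rw [← hk]
      simpa using hu
    calc (t ^ k) ((t ^ j) (σ v v)) = (t ^ j) ((t ^ k) (σ v v)) :=
          Equiv.congr_fun (Commute.zpow_zpow_self t k j).eq (σ v v)
      _ = (t ^ j) (t (σ v v)) := by rw [hbase]
      _ = t ((t ^ j) (σ v v)) :=
          Equiv.congr_fun (Commute.zpow_self t j).eq (σ v v)
  obtain ⟨j, hj⟩ := htrans (σ v v) (σ v u)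
  obtain ⟨m, hm⟩ := (mem_powers_iff_mem_zpowers (x := t)).mpr
    (Subgroup.mem_zpowers_iff.mpr ⟨j, rfl⟩)
  have hone : t = 1 := by
    rw [← huv]
    refine sigma_mul_inv_eq_one hlaw u v m ?_
    rw [huv, ← hj, ← hm]
  refine Nat.card_eq_one_iff_unique.mpr ⟨⟨fun x y => ?_⟩, ⟨v⟩⟩
  obtain ⟨k, hk⟩ := htrans x y
  simpa [hone] using hk
end
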